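/- arXiv:math/0307370 — 3 statements merged into one kernel-verified Lean document; each statement's English description precedes it below -/
import Mathlib

section
/- Let G be a plane graph with a vertex v of degree two in a Laman spanning subgraph of G, such that G ∖ v (the plane graph obtained by deleting v and its incident edges) is generically rigid in the plane. Then every CPT-labelling of G ∖ v with the generalized Laman property extends to a CPT-labelling of G with the generalized Laman property (i.e., one in which all angles common to G and G ∖ v keep their labels). -/
/-! ## Combinatorial plane graphs via rotation systems -/

/-- The permutation of darts of a simple graph reversing each dart. -/
def dartSymmPerm {V : Type} (G : SimpleGraph V) : Equiv.Perm G.Dart where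
  toFun := SimpleGraph.Dart.symm
  invFun := SimpleGraph.Dart.symm
  left_inv d := SimpleGraph.Dart.symm_symm d
  right_inv d := SimpleGraph.Dart.symm_symm d

/-- The setoid on `α` whose classes are the cycles (orbits) of a permutation `σ`. -/
def faceSetoid {α : Type} (σ : Equiv.Perm α) : Setoid α :=
  ⟨σ.SameCycle, ⟨fun x => Equiv.Perm.SameCycle.refl σ x,
    fun h => h.symm, fun h h' => h.trans h'⟩⟩

/-- A (topological, non-crossing) embedding of a connected graph `G` in the plane, encoded
combinatorially: a rotation system (the counterclockwise cyclic order of the darts around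
each vertex), which is planar in the sense of Euler's formula (the number of orbits of the
face permutation `rot * symm` is the number of faces), together with a distinguished
outer (unbounded) face.  A *plane graph* is a graph `G` together with such a structure. -/
structure PlaneEmb {V : Type} (G : SimpleGraph V) where
  rot : Equiv.Perm G.Dart
  rot_fst : ∀ d : G.Dart, (rot d).fst = d.fst
  rot_vertex : ∀ d d' : G.Dart, d.fst = d'.fst → ∃ n : ℕ, (rot ^ n) d = d'
  connected : G.Connected
  outer : Quotient (faceSetoid (rot * dartSymmPerm G))
  euler : Nat.card V + Nat.card (Quotient (faceSetoid (rot * dartSymmPerm G)))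
      = Nat.card G.edgeSet + 2

namespace PlaneEmb

variable {V : Type} {G : SimpleGraph V}

/-- The faces of a plane graph: orbits of the face permutation. -/
abbrev Face (E : PlaneEmb G) : Type := Quotient (faceSetoid (E.rot * dartSymmPerm G))

/-- The face having the dart `d` on its contour. -/
def dartFace (E : PlaneEmb G) (d : G.Dart) : E.Face :=
  Quotient.mk (faceSetoid (E.rot * dartSymmPerm G)) d

/-- Each dart `d` determines an *angle* of the plane graph, namely the angle at the vertex
`d.fst` between the edges of `d` and `rot d`; `E.angleFace d` is the face this angle lies in. -/
def angleFace (E : PlaneEmb G) (d : G.Dart) : E.Face :=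
  Quotient.mk (faceSetoid (E.rot * dartSymmPerm G)) d.symm

end PlaneEmb

/-- A vertex is *pointed* (w.r.t. an assignment `big` of which angles are labelled big)
if some angle at it is labelled big. -/
def PointedVx {V : Type} {G : SimpleGraph V} (big : G.Dart → Prop) (v : V) : Prop :=
  ∃ d : G.Dart, big d ∧ d.fst = v

/-- A *combinatorial pseudo-triangulation labelling* (CPT-labelling): every bounded face has
exactly three small angles, all angles of the unbounded face are big, and no vertex is
incident to more than one big angle. -/
structure IsCPTLabelling {V : Type} {G : SimpleGraph V} (E : PlaneEmb G)
    (big : G.Dart → Prop) : Prop where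
  bounded_small : ∀ F : E.Face, F ≠ E.outer →
    Nat.card {d : G.Dart | E.angleFace d = F ∧ ¬ big d} = 3
  outer_big : ∀ d : G.Dart, E.angleFace d = E.outer → big d
  one_big : ∀ d d' : G.Dart, big d → big d' → d.fst = d'.fst → d = d'

/-- The generalized Laman property of a combinatorial pseudo-triangulation: any `x` non-pointed
plus `y` pointed vertices, with `x + y ≥ 2`, induce at most `3x + 2y - 3` edges. -/
def GenLaman {V : Type} (G : SimpleGraph V) (big : G.Dart → Prop) : Prop :=
  ∀ S : Set V, 2 ≤ Nat.card S →
    (Nat.card ((G.induce S).edgeSet) : ℤ) ≤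
      3 * Nat.card {v ∈ S | ¬ PointedVx big v} + 2 * Nat.card {v ∈ S | PointedVx big v} - 3

/-! ## Rigidity -/

/-- Dot product in the plane. -/
def dot2 (u w : ℝ × ℝ) : ℝ := u.1 * w.1 + u.2 * w.2

/-- Rotation by 90 degrees. -/
def rot90 (u : ℝ × ℝ) : ℝ × ℝ := (-u.2, u.1)

/-- `q` is an infinitesimal motion of the bar-and-joint framework `(G, p)`. -/
def IsInfMotion {V : Type} (G : SimpleGraph V) (p q : V → ℝ × ℝ) : Prop :=
  ∀ u v : V, G.Adj u v → dot2 (p u - p v) (q u - q v) = 0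

/-- Trivial infinitesimal motions: those coming from rigid motions of the plane
(infinitesimal rotations and translations). -/
def IsTrivialMotion {V : Type} (p q : V → ℝ × ℝ) : Prop :=
  ∃ (a : ℝ) (t : ℝ × ℝ), ∀ v : V, q v = a • rot90 (p v) + t

/-- The framework `(G, p)` is infinitesimally rigid: it has no non-trivial infinitesimal
motions. -/
def InfRigid {V : Type} (G : SimpleGraph V) (p : V → ℝ × ℝ) : Prop :=
  ∀ q : V → ℝ × ℝ, IsInfMotion G p q → IsTrivialMotion p q

/-- A configuration of points is *generic* if its coordinates are algebraically
independent over `ℚ`. -/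
def GenericConf {V : Type} (p : V → ℝ × ℝ) : Prop :=
  AlgebraicIndependent ℚ (fun x : V ⊕ V => Sum.elim (fun v => (p v).1) (fun v => (p v).2) x)

/-- A graph is *generically rigid in the plane* if every generic framework on it has no
non-trivial infinitesimal motions. -/
def GenRigid {V : Type} (G : SimpleGraph V) : Prop :=
  ∀ p : V → ℝ × ℝ, GenericConf p → InfRigid G p

/-- A graph is *isostatic* (generically minimally rigid) if it is generically rigid and
removing any edge destroys generic rigidity. -/
def Isostatic {V : Type} (G : SimpleGraph V) : Prop :=
  GenRigid G ∧ ∀ e ∈ G.edgeSet, ¬ GenRigid (G.deleteEdges {e})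

/-- Laman's condition: exactly `2n - 3` edges, and every `k ≥ 2` vertices span at most
`2k - 3` edges. -/
def LamanGraph {V : Type} (L : SimpleGraph V) : Prop :=
  (Nat.card L.edgeSet : ℤ) = 2 * Nat.card V - 3 ∧
  ∀ S : Set V, 2 ≤ Nat.card S →
    (Nat.card ((L.induce S).edgeSet) : ℤ) ≤ 2 * Nat.card S - 3

/-! ## Geometry: straight-line drawings, angles, stretching -/

/-- The counterclockwise angle from the direction `u` to the direction `w`,
normalized to lie in `(0, 2π]` (a full turn for `w` pointing in the direction of `u`). -/
noncomputable def ccwAngle (u w : ℝ × ℝ) : ℝ :=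
  if 0 < Complex.arg ((⟨w.1, w.2⟩ : ℂ) / (⟨u.1, u.2⟩ : ℂ)) then
    Complex.arg ((⟨w.1, w.2⟩ : ℂ) / (⟨u.1, u.2⟩ : ℂ))
  else Complex.arg ((⟨w.1, w.2⟩ : ℂ) / (⟨u.1, u.2⟩ : ℂ)) + 2 * Real.pi

/-- The (counterclockwise) geometric angle, in the straight-line drawing `p`, of the angle of
the dart `d`, i.e. the angle at `d.fst` between the edge of `d` and the edge of `rot d`. -/
noncomputable def dartAngle {V : Type} {G : SimpleGraph V} (E : PlaneEmb G)
    (p : V → ℝ × ℝ) (d : G.Dart) : ℝ :=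
  ccwAngle (p d.snd - p d.fst) (p (E.rot d).snd - p (E.rot d).fst)

/-- A straight-line drawing is non-crossing: distinct edges meet only in common endpoints,
and no vertex lies on an edge not incident to it. -/
def NonCrossing {V : Type} (G : SimpleGraph V) (p : V → ℝ × ℝ) : Prop :=
  (∀ a b c d : V, G.Adj a b → G.Adj c d → ({a, b} : Set V) ≠ {c, d} →
    segment ℝ (p a) (p b) ∩ segment ℝ (p c) (p d) ⊆ p '' ({a, b} ∩ {c, d} : Set V)) ∧
  (∀ x a b : V, G.Adj a b → x ≠ a → x ≠ b → p x ∉ segment ℝ (p a) (p b))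

/-- The points of the drawing are in general position: no three of them are collinear. -/
def GenPos {V : Type} (p : V → ℝ × ℝ) : Prop :=
  ∀ u v w : V, u ≠ v → u ≠ w → v ≠ w → ¬ Collinear ℝ ({p u, p v, p w} : Set (ℝ × ℝ))

/-- The straight-line drawing `p` realizes the plane graph `(G, E)`: it is injective and
non-crossing, and around every (non-isolated) vertex the counterclockwise angles between
rotation-consecutive darts sum to `2π`, so the drawing induces the given rotation system. -/
def RealizesEmb {V : Type} [Fintype V] [DecidableEq V] (G : SimpleGraph V)
    [DecidableRel G.Adj] (E : PlaneEmb G) (p : V → ℝ × ℝ) : Prop :=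
  Function.Injective p ∧ NonCrossing G p ∧
  ∀ v : V, (∃ d : G.Dart, d.fst = v) →
    ∑ d ∈ Finset.univ.filter (fun d : G.Dart => d.fst = v), dartAngle E p d = 2 * Real.pi

/-- The drawing `p` *stretches* the angle labelling `big` of the plane graph `(G, E)`:
it realizes the embedding, has its (finitely many) vertices in general position, and every
angle labelled big is reflex (> 180°) while every angle labelled small is convex (< 180°).
If `big` is a CPT-labelling this makes `p` a pseudo-triangulation of its vertex set:
every bounded face is a pseudo-triangle and the convex hull edges are present. -/
def Stretches {V : Type} [Fintype V] [DecidableEq V] (G : SimpleGraph V)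
    [DecidableRel G.Adj] (E : PlaneEmb G) (big : G.Dart → Prop) (p : V → ℝ × ℝ) : Prop :=
  RealizesEmb G E p ∧ GenPos p ∧
  ∀ d : G.Dart, (big d → Real.pi < dartAngle E p d) ∧ (¬ big d → dartAngle E p d < Real.pi)

/-- The drawing `p` makes the plane graph `(G, E)` a pseudo-triangulation of its vertex set
(with the given embedding): for the labelling of the angles of the drawing as big (reflex)
or small (convex), every bounded face has exactly three small angles (is a pseudo-triangle)
and all outer angles are big (so the convex hull edges are present). -/
def StretchesToPT {V : Type} [Fintype V] [DecidableEq V] (G : SimpleGraph V)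
    [DecidableRel G.Adj] (E : PlaneEmb G) (p : V → ℝ × ℝ) : Prop :=
  ∃ big : G.Dart → Prop, IsCPTLabelling E big ∧ Stretches G E big p

/-- A vertex `v` of a geometric straight-line drawing is *pointed* if all the edges at `v`
lie in a closed half-plane supported at `v`. -/
def GeoPointed {V : Type} (G : SimpleGraph V) (p : V → ℝ × ℝ) (v : V) : Prop :=
  ∃ u : ℝ × ℝ, u ≠ 0 ∧ ∀ w : V, G.Adj v w → 0 ≤ dot2 u (p w - p v)

/-! ## Subgraphs, outer face, corners -/

/-- One step of dual connectivity avoiding the edge set `A`: the faces `F`, `F'` are the two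
sides of some edge of `G` not belonging to `A`. -/
def FaceStep {V : Type} {G : SimpleGraph V} (E : PlaneEmb G) (A : Set (Sym2 V)) :
    E.Face → E.Face → Prop :=
  fun F F' => ∃ d : G.Dart, E.dartFace d = F ∧ E.dartFace d.symm = F' ∧ d.edge ∉ A

/-- The face `F` of `G` is contained in the outer (unbounded) face of the plane subgraph of
`G` with edge set `A`: `F` can reach the outer face of `G` in the dual graph without
crossing the edges of `A`. -/
def InOuterOf {V : Type} {G : SimpleGraph V} (E : PlaneEmb G) (A : Set (Sym2 V))
    (F : E.Face) : Prop :=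
  Relation.ReflTransGen (FaceStep E A) F E.outer

/-- `v` is a *corner* of the subgraph `H` of the combinatorial pseudo-triangulation
`(G, E, big)`: either `v` is pointed in `G` and its big angle is contained in the
outer face of `H`, or `v` is non-pointed in `G` and two consecutive (small) angles at `v`
are contained in the outer face of `H`. -/
def IsCPTCorner {V : Type} {G : SimpleGraph V} (E : PlaneEmb G) (big : G.Dart → Prop)
    (H : G.Subgraph) (v : V) : Prop :=
  (v ∈ H.verts ∧ ∃ d : G.Dart, big d ∧ d.fst = v ∧ InOuterOf E H.edgeSet (E.angleFace d)) ∨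
  (v ∈ H.verts ∧ ¬ PointedVx big v ∧ ∃ d : G.Dart, d.fst = v ∧
    InOuterOf E H.edgeSet (E.angleFace d) ∧ InOuterOf E H.edgeSet (E.angleFace (E.rot d)) ∧
    (E.rot d).edge ∉ H.edgeSet)

/-- A plane graph has *non-degenerate faces* if no edge appears twice on the contour cycle of
a face, i.e. the edges incident to every face form a simple closed cycle. -/
def NonDegenerateFaces {V : Type} {G : SimpleGraph V} (E : PlaneEmb G) : Prop :=
  ∀ d : G.Dart, ¬ (E.rot * dartSymmPerm G).SameCycle d d.symm


/-- The dart `d` of `G` corresponds to the dart `d'` of the induced subgraph `G[s]`. -/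
def DelCorr {V : Type} (G : SimpleGraph V) (s : Set V)
    (d' : (G.induce s).Dart) (d : G.Dart) : Prop :=
  d.toProd = ((d'.fst : V), (d'.snd : V))

/-- `E'` is the plane embedding of the vertex-deleted graph `G ∖ v` induced by the plane
embedding `E` of `G`: the rotation of `E'` is obtained from the rotation of `E` by skipping
at each vertex the darts going to `v`, and the outer face of `E'` is the face corresponding
to the outer face of `E`. -/
def IsInducedPlaneEmbDel {V : Type} (G : SimpleGraph V) (v : V) (E : PlaneEmb G)
    (E' : PlaneEmb (G.induce ({v}ᶜ : Set V))) : Prop :=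
  (∀ (d' : (G.induce ({v}ᶜ : Set V)).Dart) (d : G.Dart), DelCorr G ({v}ᶜ) d' d →
    ∃ (e : G.Dart) (k : ℕ), DelCorr G ({v}ᶜ) (E'.rot d') e ∧ 0 < k ∧ (E.rot ^ k) d = e ∧
      ∀ j : ℕ, 0 < j → j < k → ((E.rot ^ j) d).snd = v) ∧
  (∃ (d' : (G.induce ({v}ᶜ : Set V)).Dart) (d : G.Dart), DelCorr G ({v}ᶜ) d' d ∧
    E'.dartFace d' = E'.outer ∧ E.dartFace d = E.outer)

/-- The labelling `big` of the angles of `G` extends the labelling `big'` of the angles of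
`G ∖ v`: every angle common to `G` and `G ∖ v` (i.e. whose two consecutive darts survive
consecutively) keeps its label. -/
def ExtendsDelLabel {V : Type} (G : SimpleGraph V) (v : V) (E : PlaneEmb G)
    (E' : PlaneEmb (G.induce ({v}ᶜ : Set V)))
    (big : G.Dart → Prop) (big' : (G.induce ({v}ᶜ : Set V)).Dart → Prop) : Prop :=
  ∀ (d' : (G.induce ({v}ᶜ : Set V)).Dart) (d : G.Dart), DelCorr G ({v}ᶜ) d' d →
    DelCorr G ({v}ᶜ) (E'.rot d') (E.rot d) → (big d ↔ big' d')

section Helpers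

/-- Combinatorial core: distributing big angles. -/
theorem cpt_distribute {N : Type} [Fintype N] [DecidableEq N] (τ : Equiv.Perm N) (hτ : ∀ j, τ j ≠ j)
    (t : N → ℕ) (c : N → Prop) [DecidablePred c]
    (h : ∑ j, t j + (Finset.univ.filter c).card = 3) :
    ∃ X Γ Y : N → Bool, (∀ j, X j = true → ¬ c j) ∧ (∀ j, Γ j = true → ¬ c j) ∧
      (∀ j, ¬ (X j = true ∧ Γ j = true)) ∧ (∀ i j, Y i = true → Y j = true → i = j) ∧
      ∀ j, (X (τ j)).toNat + (Γ j).toNat + (Y j).toNat = t j := by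
  classical
  have key : ∀ (t : N → ℕ), (∀ j, t j = 0) ∨ ∃ j, ∃ t' : N → ℕ, 
      (∀ i, t i = t' i + (decide (i = j)).toNat) ∧ ∑ i, t i = ∑ i, t' i + 1 := by
    intro t
    by_cases h0 : ∀ j, t j = 0
    · exact Or.inl h0
    · push Not at h0
      obtain ⟨j, hj⟩ := h0
      refine Or.inr ⟨j, fun i => t i - (decide (i = j)).toNat, ?_, ?_⟩
      · intro i
        by_cases hi : i = j
        · subst hi; simp; omega
        · simp [hi]
      · have : ∀ i, t i = (t i - (decide (i = j)).toNat) + (if i = j then 1 else 0) := by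
          intro i
          by_cases hi : i = j
          · subst hi; simp; omega
          · simp [hi]
        rw [Finset.sum_congr rfl (fun i _ => this i), Finset.sum_add_distrib]
        simp
  rcases key t with h0 | ⟨j, t', ht', hs'⟩
  · exact ⟨fun _ => false, fun _ => false, fun _ => false, by simp, by simp, by simp, by simp,
      by simp [h0]⟩
  rcases key t' with h0 | ⟨j', t'', ht'', hs''⟩
  · refine ⟨fun _ => false, fun _ => false, fun i => decide (i = j), by simp, by simp, by simp,
      ?_, ?_⟩
    · intro a b ha hb; simp at ha hb; rw [ha, hb]
    · intro i; simp [ht', h0]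
  have hY : ∀ a b : N, decide (a = j) = true → decide (b = j) = true → a = b := by
    intro a b ha hb; simp at ha hb; rw [ha, hb]
  rcases key t'' with h0 | ⟨j'', t3, ht3, hs3⟩
  · by_cases hc : c j'
    · have hc' : ¬ c (τ j') := by
        intro hc'
        have : ({j', τ j'} : Finset N) ⊆ Finset.univ.filter c := by
          intro x hx; simp at hx; rcases hx with rfl | rfl <;> simp [*]
        have := Finset.card_le_card this
        rw [Finset.card_pair (hτ j').symm] at this
        omega
      refine ⟨fun i => decide (i = τ j'), fun _ => false, fun i => decide (i = j), ?_, by simp,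
        by simp, hY, ?_⟩
      · intro i hi; simp at hi; rw [hi]; exact hc'
      · intro i; rw [ht', ht'', h0]; simp
    · refine ⟨fun _ => false, fun i => decide (i = j'), fun i => decide (i = j), by simp, ?_,
        by simp, hY, ?_⟩
      · intro i hi; simp at hi; rw [hi]; exact hc
      · intro i; rw [ht', ht'', h0]; simp
  · have hc : ∀ i, ¬ c i := by
      have : (Finset.univ.filter c).card = 0 := by omega
      intro i hi
      rw [Finset.card_eq_zero] at this
      have h2 : i ∈ Finset.univ.filter c := by simp [hi]
      rw [this] at h2; simp at h2
    have h3 : ∀ i, t3 i = 0 := by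
      have : ∑ i, t3 i = 0 := by omega
      simpa using this
    by_cases hjj : j' = j''
    · subst hjj
      refine ⟨fun i => decide (i = τ j'), fun i => decide (i = j'), fun i => decide (i = j),
        fun i _ => hc i, fun i _ => hc i, ?_, hY, ?_⟩
      · intro i hi
        simp at hi
        exact hτ j' (hi.1.symm.trans hi.2)
      · intro i; rw [ht', ht'', ht3, h3]; simp
    · refine ⟨fun _ => false, fun i => decide (i = j') || decide (i = j''), 
        fun i => decide (i = j), fun i _ => hc i, fun i _ => hc i, by simp, hY, ?_⟩
      intro i
      rw [ht', ht'', ht3, h3]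
      by_cases h1 : i = j'
      · have : i ≠ j'' := fun h => hjj (h1.symm.trans h)
        simp [h1, hjj]
      · simp [h1]

end Helpers

section Helpers2

variable {V : Type} {G : SimpleGraph V}

theorem dart_eq_of {d e : G.Dart} (h1 : d.fst = e.fst) (h2 : d.snd = e.snd) : d = e :=
  SimpleGraph.Dart.ext _ _ (Prod.ext h1 h2)

/-- inclusion of darts -/
def iotaD (v : V) (d' : (G.induce ({v}ᶜ : Set V)).Dart) : G.Dart :=
  ⟨((d'.fst : V), (d'.snd : V)), d'.adj⟩

@[simp] theorem iotaD_fst (v : V) (d' : (G.induce ({v}ᶜ : Set V)).Dart) :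
    (iotaD v d').fst = d'.fst := rfl

@[simp] theorem iotaD_snd (v : V) (d' : (G.induce ({v}ᶜ : Set V)).Dart) :
    (iotaD v d').snd = d'.snd := rfl

theorem iotaD_symm (v : V) (d' : (G.induce ({v}ᶜ : Set V)).Dart) :
    (iotaD v d').symm = iotaD v d'.symm := rfl

theorem iotaD_fst_ne (v : V) (d' : (G.induce ({v}ᶜ : Set V)).Dart) :
    (iotaD v d').fst ≠ v := d'.fst.2

theorem iotaD_snd_ne (v : V) (d' : (G.induce ({v}ᶜ : Set V)).Dart) :
    (iotaD v d').snd ≠ v := d'.snd.2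

theorem iotaD_inj (v : V) : Function.Injective (iotaD (G := G) v) := by
  intro a b h
  apply dart_eq_of
  · exact Subtype.ext (congrArg (fun d : G.Dart => d.fst) h)
  · exact Subtype.ext (congrArg (fun d : G.Dart => d.snd) h)

theorem exists_iotaD (v : V) (d : G.Dart) (h1 : d.fst ≠ v) (h2 : d.snd ≠ v) :
    ∃ d', iotaD v d' = d :=
  ⟨⟨(⟨d.fst, h1⟩, ⟨d.snd, h2⟩), d.adj⟩, rfl⟩

theorem delCorr_iff (v : V) (d' : (G.induce ({v}ᶜ : Set V)).Dart) (d : G.Dart) :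
    DelCorr G ({v}ᶜ) d' d ↔ d = iotaD v d' := by
  constructor
  · intro h; exact SimpleGraph.Dart.ext _ _ h
  · rintro rfl; rfl

theorem dartFace_rot (E : PlaneEmb G) (d : G.Dart) :
    E.dartFace (E.rot d) = E.angleFace d := by
  apply Quotient.sound
  show (E.rot * dartSymmPerm G).SameCycle (E.rot d) d.symm
  have : (E.rot * dartSymmPerm G) d.symm = E.rot d := by
    simp [dartSymmPerm]
  rw [← this]
  exact (Equiv.Perm.sameCycle_apply_left).2 (Equiv.Perm.SameCycle.refl _ _)

theorem sameCycle_lift {α β : Type} (σ : Equiv.Perm α) (h : α → β) (hh : ∀ a, h (σ a) = h a)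
    {a b : α} (hab : σ.SameCycle a b) : h a = h b := by
  obtain ⟨n, rfl⟩ := hab
  have hinv : ∀ a, h (σ⁻¹ a) = h a := fun a => by
    rw [← hh (σ⁻¹ a)]; simp
  induction n using Int.induction_on generalizing a with
  | zero => simp
  | succ n ih => rw [zpow_add_one, Equiv.Perm.mul_apply, ← ih, hh]
  | pred n ih => rw [zpow_sub_one, Equiv.Perm.mul_apply, ← ih, hinv]

theorem rot_fix (E : PlaneEmb G) {d e : G.Dart} (h : E.rot d = d) (he : d.fst = e.fst) : e = d := by
  obtain ⟨n, rfl⟩ := E.rot_vertex d e he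
  exact (Equiv.Perm.pow_apply_eq_self_of_apply_eq_self h n)

/-- the darts at `v` -/
abbrev NDart (G : SimpleGraph V) (v : V) : Type := {d : G.Dart // d.fst = v}

/-- rotation at `v` -/
def tauP (E : PlaneEmb G) (v : V) : Equiv.Perm (NDart G v) :=
  E.rot.subtypePerm (fun d => by rw [E.rot_fst d])

@[simp] theorem tauP_val (E : PlaneEmb G) (v : V) (j : NDart G v) :
    (tauP E v j).1 = E.rot j.1 := rfl

theorem ndart_symm_snd {v : V} (j : NDart G v) : j.1.symm.snd = v := j.2

theorem ndart_snd_ne {v : V} (j : NDart G v) : j.1.snd ≠ v := by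
  have := j.1.fst_ne_snd
  rw [j.2] at this
  exact this.symm

theorem ndart_snd_inj {v : V} : Function.Injective (fun j : NDart G v => j.1.snd) := by
  intro a b h
  exact Subtype.ext (dart_eq_of (a.2.trans b.2.symm) h)

theorem two_le_ndart [Fintype V] {v : V} (L : SimpleGraph V) (hLG : L ≤ G)
    (hdeg : Nat.card (L.neighborSet v) = 2) : 
    ∃ i j : NDart G v, i ≠ j := by
  classical
  have : Nontrivial (L.neighborSet v) := by
    rw [← Finite.one_lt_card_iff_nontrivial]; omega
  obtain ⟨a, b, hab⟩ := this
  refine ⟨⟨⟨(v, a.1), hLG a.2⟩, rfl⟩, ⟨⟨(v, b.1), hLG b.2⟩, rfl⟩, ?_⟩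
  intro h
  apply hab
  have := congrArg (fun j : NDart G v => j.1.snd) h
  exact Subtype.ext this

theorem tauP_ne (E : PlaneEmb G) {v : V} (h : ∃ i j : NDart G v, i ≠ j) (j : NDart G v) :
    tauP E v j ≠ j := by
  intro hj
  have h1 : E.rot j.1 = j.1 := congrArg Subtype.val hj
  obtain ⟨a, b, hab⟩ := h
  apply hab
  have ha := rot_fix E h1 (j.2.trans a.2.symm)
  have hb := rot_fix E h1 (j.2.trans b.2.symm)
  exact Subtype.ext (ha.trans hb.symm)

/-- at each nbr of v, the dart towards v is not rot-fixed -/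
theorem rot_symm_ne (E : PlaneEmb G) {v : V} (h : ∃ i j : NDart G v, i ≠ j)
    (hc : (G.induce ({v}ᶜ : Set V)).Connected) (j : NDart G v) :
    E.rot j.1.symm ≠ j.1.symm := by
  intro hj
  obtain ⟨i, hij⟩ : ∃ i, i ≠ j := by
    obtain ⟨a, b, hab⟩ := h
    by_cases ha : a = j
    · exact ⟨b, fun hb => hab (ha.trans hb.symm)⟩
    · exact ⟨a, ha⟩
  have hne : (⟨j.1.snd, ndart_snd_ne j⟩ : ({v}ᶜ : Set V)) ≠ ⟨i.1.snd, ndart_snd_ne i⟩ := by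
    intro h
    exact hij (ndart_snd_inj (congrArg Subtype.val h)).symm
  have : Nontrivial ({v}ᶜ : Set V) := ⟨_, _, hne⟩
  obtain ⟨w, hw⟩ := hc.preconnected.exists_adj_of_nontrivial ⟨j.1.snd, ndart_snd_ne j⟩
  have hw' : G.Adj j.1.snd w := hw
  have := rot_fix E hj (e := ⟨(j.1.snd, w.1), hw'⟩) rfl
  have h2 := congrArg (fun d : G.Dart => d.snd) this
  simp at h2
  exact w.2 (h2.trans j.2)

theorem exists_gam (E : PlaneEmb G) {v : V} (h : ∃ i j : NDart G v, i ≠ j)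
    (hc : (G.induce ({v}ᶜ : Set V)).Connected) (j : NDart G v) :
    ∃ d', E.rot (iotaD v d') = j.1.symm := by
  have hr : E.rot (E.rot⁻¹ j.1.symm) = j.1.symm := by simp
  have hf : (E.rot⁻¹ j.1.symm).fst = j.1.snd := by
    rw [← E.rot_fst, hr]; rfl
  have h2 : (E.rot⁻¹ j.1.symm).snd ≠ v := by
    intro h2
    have : E.rot⁻¹ j.1.symm = j.1.symm := dart_eq_of hf (h2.trans (ndart_symm_snd j).symm)
    apply rot_symm_ne E h hc j
    rw [← this]
    exact hr.trans this.symm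
  obtain ⟨d', hd'⟩ := exists_iotaD v _ (by rw [hf]; exact ndart_snd_ne j) h2
  exact ⟨d', by rw [hd', hr]⟩

theorem rot_common (E : PlaneEmb G) {v : V} {E' : PlaneEmb (G.induce ({v}ᶜ : Set V))}
    (hind : IsInducedPlaneEmbDel G v E E') (d' : (G.induce ({v}ᶜ : Set V)).Dart)
    (hd : (E.rot (iotaD v d')).snd ≠ v) : E.rot (iotaD v d') = iotaD v (E'.rot d') := by
  obtain ⟨e, k, he, hk, hke, hj⟩ := hind.1 d' (iotaD v d') ((delCorr_iff _ _ _).2 rfl)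
  rw [delCorr_iff] at he
  by_cases hk1 : k = 1
  · subst hk1; rw [← he, ← hke]; simp
  · exact absurd (by simpa using hj 1 (by omega) (by omega)) hd

theorem rot_gam (E : PlaneEmb G) {v : V} (h : ∃ i j : NDart G v, i ≠ j)
    {E' : PlaneEmb (G.induce ({v}ᶜ : Set V))}
    (hind : IsInducedPlaneEmbDel G v E E') (d' : (G.induce ({v}ᶜ : Set V)).Dart)
    (j : NDart G v) (hd : E.rot (iotaD v d') = j.1.symm) :
    E.rot j.1.symm = iotaD v (E'.rot d') := by
  obtain ⟨e, k, he, hk, hke, hj⟩ := hind.1 d' (iotaD v d') ((delCorr_iff _ _ _).2 rfl)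
  rw [delCorr_iff] at he
  rcases Nat.lt_trichotomy k 2 with h2 | h2 | h2
  · have : k = 1 := by omega
    subst this
    exfalso
    rw [pow_one, hd] at hke
    have : e.snd = v := by rw [← hke]; exact ndart_symm_snd j
    rw [he] at this
    exact iotaD_snd_ne v _ this
  · subst h2
    rw [← he, ← hke, pow_two, Equiv.Perm.mul_apply, hd]
  · exfalso
    have := hj 2 (by omega) h2
    rw [pow_two, Equiv.Perm.mul_apply, hd] at this
    exact rot_symm_ne E h E'.connected j
      (dart_eq_of (E.rot_fst _) (this.trans (ndart_symm_snd j).symm))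

theorem snd_rot_eq (E : PlaneEmb G) {v : V} (d : G.Dart) (h : (E.rot d).snd = v) :
    ∃ j : NDart G v, E.rot d = j.1.symm :=
  ⟨⟨(E.rot d).symm, h⟩, by simp⟩

end Helpers2

section Helpers3
variable {V : Type} {G : SimpleGraph V}

theorem edge_card_ge [Fintype V] (v : V) :
    Nat.card (G.induce ({v}ᶜ : Set V)).edgeSet + Nat.card (NDart G v) ≤ Nat.card G.edgeSet := by
  classical
  rw [← Nat.card_sum]
  refine Nat.card_le_card_of_injective
    (Sum.elim (SimpleGraph.Embedding.induce ({v}ᶜ : Set V)).mapEdgeSet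
      (fun j => ⟨j.1.edge, j.1.edge_mem⟩)) ?_
  apply Function.Injective.sumElim
  · exact (SimpleGraph.Embedding.mapEdgeSet _).injective
  · intro a b hab
    have h := congrArg Subtype.val hab
    simp only at h
    rcases SimpleGraph.dart_edge_eq_iff _ _ |>.1 h with h | h
    · exact Subtype.ext h
    · exfalso
      apply ndart_snd_ne b
      have := a.2; rw [h] at this; exact this
  · rintro ⟨e, he⟩ j h
    have h := congrArg Subtype.val h
    induction e using Sym2.ind with
    | _ a b =>
      have h1 : v ∈ j.1.edge := by
        have : j.1.fst ∈ j.1.edge := by 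
          simp [SimpleGraph.Dart.edge]
        rwa [j.2] at this
      simp only at h
      rw [← h] at h1
      have h1 : v ∈ s((a : V), (b : V)) := h1
      rw [Sym2.mem_iff] at h1
      rcases h1 with h1 | h1
      · exact a.2 h1.symm
      · exact b.2 h1.symm

theorem edge_card_le [Fintype V] (v : V) (S : Set V) :
    Nat.card (G.induce S).edgeSet ≤
      Nat.card ((G.induce ({v}ᶜ : Set V)).induce (Subtype.val ⁻¹' S)).edgeSet +
      Nat.card {j : NDart G v | v ∈ S ∧ j.1.snd ∈ S} := by
  classical
  rw [← Nat.card_sum]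
  let φ : (G.induce ({v}ᶜ : Set V)).induce (Subtype.val ⁻¹' S) →g G.induce S :=
    ⟨fun x => ⟨x.1.1, x.2⟩, fun h => h⟩
  refine Nat.card_le_card_of_surjective
    (Sum.elim φ.mapEdgeSet
      (fun j => ⟨s(⟨v, j.2.1⟩, ⟨j.1.1.snd, j.2.2⟩), by
        have := j.1.1.adj
        rw [j.1.2] at this
        exact this⟩)) ?_
  rintro ⟨e, he⟩
  induction e using Sym2.ind with
  | _ a b =>
    have hab : G.Adj a b := he
    by_cases ha : a.1 = v
    · refine ⟨Sum.inr ⟨⟨⟨(a.1, b.1), hab⟩, ha⟩, ?_, b.2⟩, ?_⟩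
      · rw [← ha]; exact a.2
      · apply Subtype.ext
        exact congrArg₂ (fun x y : S => s(x, y)) (Subtype.ext ha.symm) rfl
    by_cases hb : b.1 = v
    · refine ⟨Sum.inr ⟨⟨⟨(b.1, a.1), hab.symm⟩, hb⟩, ?_, a.2⟩, ?_⟩
      · rw [← hb]; exact b.2
      · apply Subtype.ext
        exact (congrArg₂ (fun x y : S => s(x, y)) (Subtype.ext hb.symm) rfl).trans Sym2.eq_swap
    · exact ⟨Sum.inl ⟨s(⟨⟨a.1, ha⟩, a.2⟩, ⟨⟨b.1, hb⟩, b.2⟩), hab⟩, rfl⟩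

end Helpers3

section Helpers4
variable {V : Type} {G : SimpleGraph V}

/-- faces at v -/
def faceN (E : PlaneEmb G) (v : V) (j : NDart G v) : E.Face := E.dartFace j.1

theorem faceN_tau (E : PlaneEmb G) (v : V) (j : NDart G v) :
    E.angleFace j.1 = faceN E v (tauP E v j) := by
  rw [← dartFace_rot]; rfl

theorem faceN_symm (E : PlaneEmb G) (v : V) (j : NDart G v) :
    E.angleFace j.1.symm = faceN E v j := rfl

theorem faceN_gam (E : PlaneEmb G) (v : V) (j : NDart G v)
    (d' : (G.induce ({v}ᶜ : Set V)).Dart) (hd : E.rot (iotaD v d') = j.1.symm) :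
    E.angleFace (iotaD v d') = faceN E v (tauP E v j) := by
  rw [← dartFace_rot, hd, ← faceN_tau]; rfl

theorem faceN_bet (E : PlaneEmb G) (v : V) (j : NDart G v) :
    E.dartFace (E.rot j.1.symm) = faceN E v j := by
  rw [dartFace_rot]; rfl

theorem faces_struct [Fintype V] (E : PlaneEmb G) {v : V} (h : ∃ i j : NDart G v, i ≠ j)
    {E' : PlaneEmb (G.induce ({v}ᶜ : Set V))}
    (hind : IsInducedPlaneEmbDel G v E E') :
    Function.Injective (faceN E v) ∧
    (∀ d' e', E'.dartFace d' = E'.dartFace e' ↔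
      (E.dartFace (iotaD v d') = E.dartFace (iotaD v e') ∨
        (E.dartFace (iotaD v d') ∈ Set.range (faceN E v) ∧
         E.dartFace (iotaD v e') ∈ Set.range (faceN E v)))) ∧
    (∀ F : E.Face, ∃ d', E.dartFace (iotaD v d') = F) := by
  classical
  have hc := E'.connected
  have hfin : Finite G.Dart := inferInstance
  have hfin' : Finite (G.induce ({v}ᶜ : Set V)).Dart := inferInstance
  have : Finite E.Face := Quotient.finite _
  have : Finite E'.Face := Quotient.finite _
  have hsurj : ∀ F : E.Face, ∃ d', E.dartFace (iotaD v d') = F := by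
    have hN : ∀ j : NDart G v, ∃ d', E.dartFace (iotaD v d') = faceN E v j := by
      intro j
      obtain ⟨d', hd'⟩ := exists_gam E h hc j
      exact ⟨E'.rot d', by rw [← rot_gam E h hind d' j hd', faceN_bet]⟩
    intro F
    obtain ⟨d, rfl⟩ := Quotient.exists_rep F
    by_cases h1 : d.fst = v
    · exact hN ⟨d, h1⟩
    by_cases h2 : d.snd = v
    · obtain ⟨d', hd'⟩ := hN (tauP E v ⟨d.symm, h2⟩)
      refine ⟨d', hd'.trans ?_⟩
      rw [← faceN_tau]
      show E.dartFace d.symm.symm = E.dartFace d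
      simp
    · obtain ⟨d', rfl⟩ := exists_iotaD v d h1 h2
      exact ⟨d', rfl⟩
  let A : Set E.Face := Set.range (faceN E v)
  let col : E.Face → Option {F : E.Face // F ∉ A} := fun F => if hF : F ∈ A then none else some ⟨F, hF⟩
  have hcol : ∀ F F', col F = col F' ↔ (F = F' ∨ (F ∈ A ∧ F' ∈ A)) := by
    intro F F'
    by_cases h1 : F ∈ A <;> by_cases h2 : F' ∈ A <;> simp [col, h1, h2]
    · rintro rfl; exact h2 h1
    · rintro rfl; exact h1 h2
  have hstep : ∀ d', col (E.dartFace (iotaD v ((E'.rot * dartSymmPerm (G.induce ({v}ᶜ : Set V))) d'))) =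
      col (E.dartFace (iotaD v d')) := by
    intro d'
    have hs : ((E'.rot * dartSymmPerm (G.induce ({v}ᶜ : Set V))) d') = E'.rot d'.symm := rfl
    rw [hs, hcol]
    by_cases hsnd : (E.rot (iotaD v d'.symm)).snd = v
    · right
      obtain ⟨j, hj⟩ := snd_rot_eq E _ hsnd
      have h1 := rot_gam E h hind _ j hj
      have h2 := faceN_gam E v j _ hj
      refine ⟨⟨j, ?_⟩, ⟨tauP E v j, ?_⟩⟩
      · rw [← h1, faceN_bet]
      · rw [← h2]; show E.dartFace (iotaD v d'.symm).symm = _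
        rw [iotaD_symm]; simp
    · left
      rw [← rot_common E hind _ hsnd, dartFace_rot]
      show E.dartFace (iotaD v d'.symm).symm = _
      rw [iotaD_symm]; simp
  let g : E'.Face → Option {F : E.Face // F ∉ A} :=
    Quotient.lift (fun d' => col (E.dartFace (iotaD v d')))
      (fun a b hab => sameCycle_lift _ (fun d' => col (E.dartFace (iotaD v d'))) hstep hab)
  have hg : ∀ d', g (E'.dartFace d') = col (E.dartFace (iotaD v d')) := fun d' => rfl
  have hgs : Function.Surjective g := by
    intro o
    have : ∃ F, col F = o := by
      cases o with
      | none =>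
        obtain ⟨i, _⟩ := h
        exact ⟨faceN E v i, dif_pos ⟨i, rfl⟩⟩
      | some F => exact ⟨F.1, by simp [col, F.2]⟩
    obtain ⟨F, rfl⟩ := this
    obtain ⟨d', rfl⟩ := hsurj F
    exact ⟨_, hg d'⟩
  -- counting
  have hle := Nat.card_le_card_of_surjective g hgs
  rw [Finite.card_option] at hle
  have e1 := E.euler
  have e2 := E'.euler
  have e3 := edge_card_ge (G := G) v
  have hV : Nat.card ({v}ᶜ : Set V) + 1 = Nat.card V := by
    rw [Nat.card_coe_set_eq]
    have := Set.ncard_add_ncard_compl ({v} : Set V)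
    rw [Set.ncard_singleton] at this
    omega
  have hA : Nat.card A + Nat.card {F : E.Face // F ∉ A} = Nat.card E.Face := by
    have := Set.ncard_add_ncard_compl A
    rw [← Nat.card_coe_set_eq, ← Nat.card_coe_set_eq] at this
    exact this
  have hAle : Nat.card A ≤ Nat.card (NDart G v) :=
    Nat.card_le_card_of_surjective _ (Set.rangeFactorization_surjective (f := faceN E v))
  have c1 : Nat.card A = Nat.card (NDart G v) := by
    unfold PlaneEmb.Face at hA hle
    omega
  have c2 : Nat.card E'.Face = Nat.card (Option {F : E.Face // F ∉ A}) := by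
    rw [Finite.card_option]
    unfold PlaneEmb.Face at *
    omega
  have b1 : Function.Injective (faceN E v) := by
    have : Function.Bijective (Set.rangeFactorization (faceN E v)) :=
      (Nat.bijective_iff_surjective_and_card _).2 ⟨Set.rangeFactorization_surjective, c1.symm⟩
    intro a b hab
    exact this.1 (Subtype.ext hab)
  have b2 : Function.Injective g := ((Nat.bijective_iff_surjective_and_card _).2 ⟨hgs, c2⟩).1
  refine ⟨b1, ?_, hsurj⟩
  intro d' e'
  rw [← hcol, ← hg, ← hg]
  exact b2.eq_iff.symm

end Helpers4

section Helpers5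
variable {V : Type} {G : SimpleGraph V}

theorem card_split {α β γ : Type} [Finite α] [Finite β] (f : α → γ) (g : β → γ)
    (hb : Function.Bijective (Sum.elim f g)) (P : γ → Prop) :
    Nat.card {c : γ | P c} = Nat.card {a : α | P (f a)} + Nat.card {b : β | P (g b)} := by
  rw [← Nat.card_sum]
  refine Nat.card_congr (Equiv.trans ?_ (Equiv.subtypeSum (p := fun c => P (Sum.elim f g c))))
  exact ((Equiv.ofBijective _ hb).subtypeEquiv (fun a => Iff.rfl)).symm

/-- darts of the vertex-deleted graph whose angle is common -/
abbrev DCom {v : V} (gam : NDart G v → (G.induce ({v}ᶜ : Set V)).Dart) : Type :=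
  {d' : (G.induce ({v}ᶜ : Set V)).Dart // ∀ j, d' ≠ gam j}

theorem gam_inj (E : PlaneEmb G) {v : V} {gam : NDart G v → (G.induce ({v}ᶜ : Set V)).Dart}
    (hgam : ∀ j, E.rot (iotaD v (gam j)) = j.1.symm) : Function.Injective gam := by
  intro a b hab
  have : a.1.symm = b.1.symm := by rw [← hgam, ← hgam, hab]
  exact Subtype.ext (SimpleGraph.Dart.symm_involutive.injective this)

theorem card_D' [Fintype V] (E : PlaneEmb G) {v : V}
    {gam : NDart G v → (G.induce ({v}ᶜ : Set V)).Dart}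
    (hgam : ∀ j, E.rot (iotaD v (gam j)) = j.1.symm)
    (P : (G.induce ({v}ᶜ : Set V)).Dart → Prop) :
    Nat.card {d' | P d'} = Nat.card {j | P (gam j)} + Nat.card {d' : DCom gam | P d'.1} := by
  classical
  apply card_split gam (fun d' : DCom gam => d'.1)
  constructor
  · apply Function.Injective.sumElim (gam_inj E hgam) Subtype.val_injective
    intro a b
    exact (b.2 a).symm
  · intro d'
    by_cases h : ∀ j, d' ≠ gam j
    · exact ⟨Sum.inr ⟨d', h⟩, rfl⟩
    · push Not at h
      obtain ⟨j, hj⟩ := h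
      exact ⟨Sum.inl j, hj.symm⟩

theorem ndart_symm_fst_ne {v : V} (j : NDart G v) : j.1.symm.fst ≠ v := ndart_snd_ne j

theorem card_D [Fintype V] (E : PlaneEmb G) {v : V}
    {gam : NDart G v → (G.induce ({v}ᶜ : Set V)).Dart}
    (hgam : ∀ j, E.rot (iotaD v (gam j)) = j.1.symm)
    (P : G.Dart → Prop) :
    Nat.card {d | P d} = Nat.card {j : NDart G v | P j.1} + Nat.card {j : NDart G v | P j.1.symm} +
      Nat.card {j | P (iotaD v (gam j))} + Nat.card {d' : DCom gam | P (iotaD v d'.1)} := by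
  classical
  have h1 : Nat.card {d | P d} = Nat.card {j : NDart G v | P j.1} +
      Nat.card {d : {d : G.Dart // d.fst ≠ v} | P d.1} := by
    apply card_split (fun d : NDart G v => d.1) (fun d : {d : G.Dart // d.fst ≠ v} => d.1)
    constructor
    · apply Function.Injective.sumElim Subtype.val_injective Subtype.val_injective
      intro a b hab
      apply b.2; rw [← hab]; exact a.2
    · intro d
      by_cases h : d.fst = v
      · exact ⟨Sum.inl ⟨d, h⟩, rfl⟩
      · exact ⟨Sum.inr ⟨d, h⟩, rfl⟩
  have h2 : Nat.card {d : {d : G.Dart // d.fst ≠ v} | P d.1} =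
      Nat.card {j : NDart G v | P j.1.symm} + Nat.card {d' | P (iotaD v d')} := by
    apply card_split (fun j : NDart G v =>
        (⟨j.1.symm, ndart_symm_fst_ne j⟩ : {d : G.Dart // d.fst ≠ v}))
      (fun d' => ⟨iotaD v d', iotaD_fst_ne v d'⟩) ?_ (fun d => P d.1)
    constructor
    · apply Function.Injective.sumElim
      · intro a b hab
        exact Subtype.ext (SimpleGraph.Dart.symm_involutive.injective (congrArg Subtype.val hab))
      · intro a b hab
        exact iotaD_inj v (congrArg Subtype.val hab)
      · intro a b hab
        have hab := congrArg Subtype.val hab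
        simp only at hab
        apply iotaD_snd_ne v b
        rw [← hab]; exact ndart_symm_snd a
    · rintro ⟨d, hd⟩
      by_cases h : d.snd = v
      · exact ⟨Sum.inl ⟨d.symm, h⟩, by simp⟩
      · obtain ⟨d', rfl⟩ := exists_iotaD v d hd h
        exact ⟨Sum.inr d', rfl⟩
  rw [h1, h2, card_D' E hgam (fun d' => P (iotaD v d'))]
  ring

/-- the extended labelling -/
def bigL {v : V} (gam : NDart G v → (G.induce ({v}ᶜ : Set V)).Dart) (X Γ Y : NDart G v → Bool)
    (big' : (G.induce ({v}ᶜ : Set V)).Dart → Prop) (d : G.Dart) : Prop :=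
  (∃ j : NDart G v, d = j.1 ∧ Y j = true) ∨ (∃ j : NDart G v, d = j.1.symm ∧ X j = true) ∨
  (∃ j, d = iotaD v (gam j) ∧ Γ j = true) ∨
  (∃ d' : DCom gam, d = iotaD v d'.1 ∧ big' d'.1)

section L
variable {v : V} (E : PlaneEmb G) {gam : NDart G v → (G.induce ({v}ᶜ : Set V)).Dart}
    (X Γ Y : NDart G v → Bool)
    (big' : (G.induce ({v}ᶜ : Set V)).Dart → Prop)

theorem n_ne_symm (i j : NDart G v) : i.1 ≠ j.1.symm := by
  intro h; apply ndart_symm_fst_ne j; rw [← h]; exact i.2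

theorem n_ne_iota (i : NDart G v) (d') : i.1 ≠ iotaD v d' := by
  intro h; apply iotaD_fst_ne v d'; rw [← h]; exact i.2

theorem symm_ne_iota (i : NDart G v) (d') : i.1.symm ≠ iotaD v d' := by
  intro h; apply iotaD_snd_ne v d'; rw [← h]; exact i.2

theorem bigL_n (j : NDart G v) : bigL gam X Γ Y big' j.1 ↔ Y j = true := by
  constructor
  · rintro (⟨i, hi, hy⟩ | ⟨i, hi, hy⟩ | ⟨i, hi, hy⟩ | ⟨i, hi, hy⟩)
    · rwa [Subtype.ext hi]
    · exact absurd hi (n_ne_symm _ _)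
    · exact absurd hi (n_ne_iota _ _)
    · exact absurd hi (n_ne_iota _ _)
  · intro h; exact Or.inl ⟨j, rfl, h⟩

theorem bigL_symm (j : NDart G v) : bigL gam X Γ Y big' j.1.symm ↔ X j = true := by
  constructor
  · rintro (⟨i, hi, hy⟩ | ⟨i, hi, hy⟩ | ⟨i, hi, hy⟩ | ⟨i, hi, hy⟩)
    · exact absurd hi.symm (n_ne_symm _ _)
    · rwa [Subtype.ext (SimpleGraph.Dart.symm_involutive.injective hi)]
    · exact absurd hi (symm_ne_iota _ _)
    · exact absurd hi (symm_ne_iota _ _)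
  · intro h; exact Or.inr (Or.inl ⟨j, rfl, h⟩)

theorem bigL_gam (hgam : ∀ j, E.rot (iotaD v (gam j)) = j.1.symm) (j : NDart G v) : bigL gam X Γ Y big' (iotaD v (gam j)) ↔ Γ j = true := by
  constructor
  · rintro (⟨i, hi, hy⟩ | ⟨i, hi, hy⟩ | ⟨i, hi, hy⟩ | ⟨i, hi, hy⟩)
    · exact absurd hi.symm (n_ne_iota _ _)
    · exact absurd hi.symm (symm_ne_iota _ _)
    · rwa [gam_inj E hgam (iotaD_inj v hi)]
    · exact absurd (iotaD_inj v hi).symm (i.2 j)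
  · intro h; exact Or.inr (Or.inr (Or.inl ⟨j, rfl, h⟩))

theorem bigL_com (d' : DCom gam) : bigL gam X Γ Y big' (iotaD v d'.1) ↔ big' d'.1 := by
  constructor
  · rintro (⟨i, hi, hy⟩ | ⟨i, hi, hy⟩ | ⟨i, hi, hy⟩ | ⟨i, hi, hy⟩)
    · exact absurd hi.symm (n_ne_iota _ _)
    · exact absurd hi.symm (symm_ne_iota _ _)
    · exact absurd (iotaD_inj v hi) (d'.2 i)
    · rwa [iotaD_inj v hi]
  · intro h; exact Or.inr (Or.inr (Or.inr ⟨d', rfl, h⟩))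

theorem gam_fst (hgam : ∀ j, E.rot (iotaD v (gam j)) = j.1.symm) (j : NDart G v) :
    ((gam j).fst : V) = j.1.snd := by
  rw [← iotaD_fst, ← E.rot_fst, hgam]; rfl

/-- shape of a big dart away from `v` -/
theorem bigL_shape (hgam : ∀ j, E.rot (iotaD v (gam j)) = j.1.symm)
    (hX : ∀ j, X j = true → big' (gam j)) (hΓ : ∀ j, Γ j = true → big' (gam j))
    (d : G.Dart) (hd : d.fst ≠ v) (hb : bigL gam X Γ Y big' d) :
    ∃ d', big' d' ∧ (d'.fst : V) = d.fst ∧ ((∃ j, d' = gam j ∧ 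
      ((d = j.1.symm ∧ X j = true) ∨ (d = iotaD v (gam j) ∧ Γ j = true))) ∨
      ((∀ j, d' ≠ gam j) ∧ d = iotaD v d')) := by
  rcases hb with (⟨i, hi, hy⟩ | ⟨i, hi, hy⟩ | ⟨i, hi, hy⟩ | ⟨i, hi, hy⟩)
  · exact absurd i.2 (hi ▸ hd)
  · refine ⟨gam i, hX i hy, ?_, Or.inl ⟨i, rfl, Or.inl ⟨hi, hy⟩⟩⟩
    rw [gam_fst E hgam, hi]; rfl
  · refine ⟨gam i, hΓ i hy, ?_, Or.inl ⟨i, rfl, Or.inr ⟨hi, hy⟩⟩⟩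
    rw [hi]; rfl
  · refine ⟨i.1, hy, ?_, Or.inr ⟨i.2, hi⟩⟩
    rw [hi]; rfl

theorem bigL_one (hgam : ∀ j, E.rot (iotaD v (gam j)) = j.1.symm)
    (hX : ∀ j, X j = true → big' (gam j)) (hΓ : ∀ j, Γ j = true → big' (gam j))
    (hXΓ : ∀ j, ¬ (X j = true ∧ Γ j = true)) (hY : ∀ i j, Y i = true → Y j = true → i = j)
    (h1 : ∀ d d', big' d → big' d' → d.fst = d'.fst → d = d')
    (d e : G.Dart) (hd : bigL gam X Γ Y big' d) (he : bigL gam X Γ Y big' e)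
    (hde : d.fst = e.fst) : d = e := by
  by_cases hv : d.fst = v
  · have hd' := (bigL_n X Γ Y big' ⟨d, hv⟩).1 hd
    have he' := (bigL_n X Γ Y big' ⟨e, hde ▸ hv⟩).1 he
    exact congrArg Subtype.val (hY _ _ hd' he')
  · obtain ⟨d', hd1, hd2, hd3⟩ := bigL_shape E X Γ Y big' hgam hX hΓ d hv hd
    obtain ⟨e', he1, he2, he3⟩ := bigL_shape E X Γ Y big' hgam hX hΓ e (hde ▸ hv) he
    have : d' = e' := h1 _ _ hd1 he1 (Subtype.ext (by rw [hd2, he2, hde]))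
    subst this
    rcases hd3 with ⟨j, hj, hd3⟩ | ⟨hn, hd3⟩
    · rcases he3 with ⟨i, hi, he3⟩ | ⟨hn, he3⟩
      · have : i = j := gam_inj E hgam (hi.symm.trans hj)
        subst this
        rcases hd3 with ⟨a, b⟩ | ⟨a, b⟩ <;> rcases he3 with ⟨a', b'⟩ | ⟨a', b'⟩
        · rw [a, a']
        · exact absurd ⟨b, b'⟩ (hXΓ _)
        · exact absurd ⟨b', b⟩ (hXΓ _)
        · rw [a, a']
      · exact absurd hj (hn j)
    · rcases he3 with ⟨i, hi, he3⟩ | ⟨hn, he3⟩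
      · exact absurd hi (hn i)
      · rw [hd3, he3]

theorem bigL_ext {E' : PlaneEmb (G.induce ({v}ᶜ : Set V))}
    (hgam : ∀ j, E.rot (iotaD v (gam j)) = j.1.symm) :
    ExtendsDelLabel G v E E' (bigL gam X Γ Y big') big' := by
  intro d' d h1 h2
  rw [delCorr_iff] at h1 h2
  subst h1
  refine bigL_com X Γ Y big' ⟨d', fun j hj => ?_⟩
  subst hj
  rw [hgam] at h2
  exact symm_ne_iota _ _ h2

theorem bigL_genLaman [Fintype V] 
    (hgam : ∀ j, E.rot (iotaD v (gam j)) = j.1.symm)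
    (hX : ∀ j, X j = true → big' (gam j)) (hΓ : ∀ j, Γ j = true → big' (gam j))
    (h1 : ∀ d d', big' d → big' d' → d.fst = d'.fst → d = d')
    (hcount : Nat.card {j | ¬ big' (gam j) ∨ X j = true ∨ Γ j = true} +
      Nat.card {j | Y j = true} ≤ 3)
    (hgl : GenLaman (G.induce ({v}ᶜ : Set V)) big') :
    GenLaman G (bigL gam X Γ Y big') := by
  classical
  intro S hS
  have hpt : ∀ a : ({v}ᶜ : Set V), PointedVx (bigL gam X Γ Y big') a.1 → PointedVx big' a := by
    rintro a ⟨d, hd, hda⟩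
    obtain ⟨d', hd1, hd2, -⟩ := bigL_shape E X Γ Y big' hgam hX hΓ d (hda ▸ a.2) hd
    exact ⟨d', hd1, Subtype.ext (hd2.trans hda)⟩
  have hlose : ∀ j : NDart G v, ¬ (¬ big' (gam j) ∨ X j = true ∨ Γ j = true) →
      ¬ PointedVx (bigL gam X Γ Y big') j.1.snd ∧ PointedVx big' ⟨j.1.snd, ndart_snd_ne j⟩ := by
    intro j hj
    push Not at hj
    obtain ⟨hj1, hj2, hj3⟩ := hj
    refine ⟨?_, ⟨gam j, hj1, Subtype.ext (gam_fst E hgam j)⟩⟩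
    rintro ⟨d, hd, hda⟩
    obtain ⟨d', hd1, hd2, hd3⟩ := bigL_shape E X Γ Y big' hgam hX hΓ d
      (hda ▸ ndart_snd_ne j) hd
    have : d' = gam j := h1 _ _ hd1 hj1 (Subtype.ext (by rw [hd2, hda, gam_fst E hgam]))
    subst this
    rcases hd3 with ⟨i, hi, hd3⟩ | ⟨hn, -⟩
    · have := gam_inj E hgam hi
      subst this
      rcases hd3 with h | h
      · exact hj2 h.2
      · exact hj3 h.2
    · exact hn j rfl
  set B := bigL gam X Γ Y big' with hB
  set S' : Set ({v}ᶜ : Set V) := Subtype.val ⁻¹' S with hS'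
  have hsum : ∀ {W : Type} [Fintype W] (T : Set W) (P : W → Prop),
      Nat.card {w ∈ T | ¬ P w} + Nat.card {w ∈ T | P w} = Nat.card T := by
    intro W _ T P
    have : Nat.card T = ({w ∈ T | P w}).ncard + ({w ∈ T | ¬ P w}).ncard := by
      rw [Nat.card_coe_set_eq, ← Set.ncard_union_eq]
      · congr 1; ext w; simp; tauto
      · rw [Set.disjoint_left]; rintro w ⟨_, h⟩ ⟨_, h'⟩; exact h' h
    have e1 : Nat.card {w ∈ T | ¬ P w} = ({w ∈ T | ¬ P w}).ncard := Nat.card_coe_set_eq _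
    have e2 : Nat.card {w ∈ T | P w} = ({w ∈ T | P w}).ncard := Nat.card_coe_set_eq _
    omega
  have hs1 := hsum S (PointedVx B)
  have hs2 := hsum S' (PointedVx big')
  have hedge := edge_card_le (G := G) v S
  rw [← hS'] at hedge
  -- the sets
  have hnp : Nat.card {w ∈ S | ¬ PointedVx B w} = ({w ∈ S | ¬ PointedVx B w}).ncard :=
    Nat.card_coe_set_eq _
  have hnp' : Nat.card {w ∈ S' | ¬ PointedVx big' w} =
      (Subtype.val '' {w ∈ S' | ¬ PointedVx big' w}).ncard := by
    rw [Set.ncard_image_of_injective _ Subtype.val_injective]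
    exact Nat.card_coe_set_eq _
  have hsub1 : Subtype.val '' {w ∈ S' | ¬ PointedVx big' w} ⊆ {w ∈ S | ¬ PointedVx B w} := by
    rintro _ ⟨w, ⟨hw, hp⟩, rfl⟩
    exact ⟨hw, fun h => hp (hpt w h)⟩
  have hScard : Nat.card S = S.ncard := Nat.card_coe_set_eq _
  have hS'card : Nat.card S' = (S \ {v}).ncard := by
    have : S \ {v} = Subtype.val '' S' := by
      ext w
      constructor
      · rintro ⟨a, b⟩; exact ⟨⟨w, b⟩, a, rfl⟩
      · rintro ⟨a, b, rfl⟩; exact ⟨b, a.2⟩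
    rw [this, Set.ncard_image_of_injective _ Subtype.val_injective]
    exact Nat.card_coe_set_eq _
  by_cases hv : v ∈ S
  · have hScard' : Nat.card S' + 1 = Nat.card S := by
      rw [hScard, hS'card]; exact Set.ncard_sdiff_singleton_add_one hv
    let NS : Set (NDart G v) := {j | j.1.snd ∈ S}
    have hNS : Nat.card {j : NDart G v | v ∈ S ∧ j.1.snd ∈ S} = NS.ncard := by
      rw [Nat.card_coe_set_eq]; simp [NS, hv]
    rw [hNS] at hedge
    have hNSle : NS.ncard ≤ Nat.card S' := by
      rw [hS'card, ← Set.ncard_image_of_injective NS ndart_snd_inj]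
      refine Set.ncard_le_ncard ?_ (Set.toFinite _)
      rintro _ ⟨j, hj, rfl⟩
      exact ⟨hj, ndart_snd_ne j⟩
    by_cases h2 : 2 ≤ Nat.card S'
    · have hI := hgl S' h2
      let NL : Set (NDart G v) := {j | ¬ big' (gam j) ∨ X j = true ∨ Γ j = true}
      have hNL : NS.ncard ≤ (NS \ NL).ncard + NL.ncard := by
        exact Set.ncard_le_ncard_sdiff_add_ncard NS NL
      have hNL' : Nat.card {j | ¬ big' (gam j) ∨ X j = true ∨ Γ j = true} = NL.ncard :=
        Nat.card_coe_set_eq _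
      have hYc : Nat.card {j | Y j = true} = ({j | Y j = true}).ncard := Nat.card_coe_set_eq _
      let U : Set V := Subtype.val '' {w ∈ S' | ¬ PointedVx big' w} ∪
        (fun j : NDart G v => j.1.snd) '' (NS \ NL)
      have hU : U.ncard = Nat.card {w ∈ S' | ¬ PointedVx big' w} + (NS \ NL).ncard := by
        rw [hnp', ← Set.ncard_image_of_injective (NS \ NL) ndart_snd_inj]
        refine Set.ncard_union_eq ?_ (Set.toFinite _) (Set.toFinite _)
        rw [Set.disjoint_left]
        rintro _ ⟨w, ⟨_, hw⟩, rfl⟩ ⟨j, ⟨_, hj⟩, hjw⟩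
        apply hw
        have := (hlose j hj).2
        convert this
        exact Subtype.ext hjw.symm
      have hUs : U ⊆ {w ∈ S | ¬ PointedVx B w} := by
        apply Set.union_subset hsub1
        rintro _ ⟨j, ⟨hj1, hj2⟩, rfl⟩
        exact ⟨hj1, (hlose j hj2).1⟩
      have hUv : v ∉ U := by
        rintro (⟨w, _, hw⟩ | ⟨j, _, hj⟩)
        · exact w.2 hw
        · exact ndart_snd_ne j hj
      by_cases hYe : ∃ j, Y j = true
      · have : 0 < ({j | Y j = true}).ncard := by
          rw [Set.ncard_pos]; exact hYe
        have := Set.ncard_le_ncard hUs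
        omega
      · have hvs : insert v U ⊆ {w ∈ S | ¬ PointedVx B w} := by
          apply Set.insert_subset _ hUs
          refine ⟨hv, ?_⟩
          rintro ⟨d, hd, hdv⟩
          exact hYe ⟨_, (bigL_n X Γ Y big' ⟨d, hdv⟩).1 hd⟩
        have := Set.ncard_le_ncard hvs
        rw [Set.ncard_insert_of_notMem hUv] at this
        omega
    · have he0 : Nat.card ((G.induce ({v}ᶜ : Set V)).induce S').edgeSet = 0 := by
        have hss : Subsingleton S' := by
          rw [← Finite.card_le_one_iff_subsingleton]; omega
        have : IsEmpty ((G.induce ({v}ᶜ : Set V)).induce S').edgeSet := by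
          constructor
          rintro ⟨e, he⟩
          induction e using Sym2.ind with
          | _ a b => 
            have he' : ((G.induce ({v}ᶜ : Set V)).induce S').Adj a b := he
            exact he'.ne (Subsingleton.elim a b)
        exact Nat.card_of_isEmpty
      omega
  · have hScard' : Nat.card S' = Nat.card S := by
      rw [hScard, hS'card, Set.sdiff_singleton_eq_self hv]
    have hI := hgl S' (by omega)
    have h0 : Nat.card {j : NDart G v | v ∈ S ∧ j.1.snd ∈ S} = 0 := by
      simp [hv]
    have := Set.ncard_le_ncard hsub1
    omega

end L
end Helpers5

section Helpers6
variable {V : Type} {G : SimpleGraph V}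

/-- number of small common angles in the face preceding `tau j` -/
noncomputable def tCount {v : V} (E : PlaneEmb G)
    (gam : NDart G v → (G.induce ({v}ᶜ : Set V)).Dart)
    (big' : (G.induce ({v}ᶜ : Set V)).Dart → Prop) (j : NDart G v) : ℕ :=
  Nat.card {d' : DCom gam | E.angleFace (iotaD v d'.1) = faceN E v (tauP E v j) ∧ ¬ big' d'.1}

theorem card_single {α : Type} (i : α) (b : α → Bool) :
    Nat.card {j | j = i ∧ ¬ b j = true} = 1 - (b i).toNat := by
  rw [Nat.card_coe_set_eq]
  cases h : b i with
  | false =>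
    have : {j | j = i ∧ ¬ b j = true} = {i} := by
      ext j; constructor
      · rintro ⟨rfl, _⟩; rfl
      · rintro rfl; exact ⟨rfl, by simp [h]⟩
    rw [this]; simp
  | true =>
    have : {j | j = i ∧ ¬ b j = true} = ∅ := by
      ext j; constructor
      · rintro ⟨rfl, h2⟩; exact absurd h h2
      · rintro ⟨⟩
    rw [this]; simp

theorem cpt_finish [Fintype V] (E : PlaneEmb G) {v : V} (h : ∃ i j : NDart G v, i ≠ j)
    {E' : PlaneEmb (G.induce ({v}ᶜ : Set V))}
    (hind : IsInducedPlaneEmbDel G v E E')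
    {gam : NDart G v → (G.induce ({v}ᶜ : Set V)).Dart}
    (hgam : ∀ j, E.rot (iotaD v (gam j)) = j.1.symm) (X Γ Y : NDart G v → Bool)
    (big' : (G.induce ({v}ᶜ : Set V)).Dart → Prop)
    (hcpt' : IsCPTLabelling E' big') (hgl' : GenLaman (G.induce ({v}ᶜ : Set V)) big')
    (hX : ∀ j, X j = true → big' (gam j)) (hΓ : ∀ j, Γ j = true → big' (gam j))
    (hXΓ : ∀ j, ¬ (X j = true ∧ Γ j = true)) (hY : ∀ i j, Y i = true → Y j = true → i = j)
    (hcount : Nat.card {j | ¬ big' (gam j) ∨ X j = true ∨ Γ j = true} +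
      Nat.card {j | Y j = true} ≤ 3)
    (hbd : ∀ j, faceN E v (tauP E v j) ≠ E.outer →
      (X (tauP E v j)).toNat + (Γ j).toNat + (Y j).toNat = tCount E gam big' j)
    (hout : ∀ j, faceN E v (tauP E v j) = E.outer →
      X (tauP E v j) = true ∧ Γ j = true ∧ Y j = true) :
    ∃ big : G.Dart → Prop, IsCPTLabelling E big ∧ GenLaman G big ∧
      ExtendsDelLabel G v E E' big big' := by
  classical
  obtain ⟨hinj, hface, hsurj⟩ := faces_struct E h hind
  obtain ⟨-, d0', d0, hd0, ho', ho⟩ := hind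
  rw [delCorr_iff] at hd0
  subst hd0
  refine ⟨bigL gam X Γ Y big', ⟨?_, ?_, ?_⟩,
    bigL_genLaman E X Γ Y big' hgam hX hΓ hcpt'.one_big hcount hgl',
    bigL_ext E X Γ Y big' hgam⟩
  · intro F hF
    rw [card_D E hgam (fun d => E.angleFace d = F ∧ ¬ bigL gam X Γ Y big' d)]
    simp only [bigL_n, bigL_symm, bigL_gam E X Γ Y big' hgam, bigL_com, faceN_tau, faceN_symm,
      faceN_gam E v _ _ (hgam _)]
    by_cases hFA : F ∈ Set.range (faceN E v)
    · obtain ⟨i, rfl⟩ := hFA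
      obtain ⟨j, rfl⟩ := (tauP E v).surjective i
      simp only [hinj.eq_iff, (tauP E v).injective.eq_iff, card_single]
      have hb := hbd j hF
      have ht : Nat.card {d' : DCom gam | E.angleFace (iotaD v d'.1) = faceN E v (tauP E v j) ∧
        ¬ big' d'.1} = tCount E gam big' j := rfl
      rw [ht, ← hb]
      cases X (tauP E v j) <;> cases Γ j <;> cases Y j <;> rfl
    · have hne : ∀ i, ¬ (faceN E v i = F) := fun i hi => hFA ⟨i, hi⟩
      simp only [hne, false_and, Set.setOf_false]
      obtain ⟨e', rfl⟩ := hsurj F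
      have hne' : E'.dartFace e' ≠ E'.outer := by
        rw [← ho']
        intro hh
        rcases (hface _ _).1 hh with h1 | h1
        · exact hF (h1.trans ho)
        · exact hFA h1.1
      have h3 := hcpt'.bounded_small _ hne'
      rw [card_D' E hgam (fun d => E'.angleFace d = E'.dartFace e' ∧ ¬ big' d)] at h3
      have hiff : ∀ d', E'.angleFace d' = E'.dartFace e' ↔
          E.angleFace (iotaD v d') = E.dartFace (iotaD v e') := by
        intro d'
        refine (hface d'.symm e').trans ?_
        constructor
        · rintro (h1 | h1)
          · exact h1
          · exact absurd h1.2 hFA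
        · exact Or.inl
      simp only [hiff, faceN_gam E v _ _ (hgam _), hne, false_and, Set.setOf_false] at h3
      simpa using h3
  · intro d hd
    by_cases h1 : d.fst = v
    · obtain ⟨j, rfl⟩ : ∃ j : NDart G v, j.1 = d := ⟨⟨d, h1⟩, rfl⟩
      rw [bigL_n]
      rw [faceN_tau] at hd
      exact (hout j hd).2.2
    by_cases h2 : d.snd = v
    · obtain ⟨j, rfl⟩ : ∃ j : NDart G v, j.1.symm = d := ⟨⟨d.symm, h2⟩, by simp⟩
      rw [bigL_symm]
      rw [faceN_symm] at hd
      obtain ⟨i, rfl⟩ := (tauP E v).surjective j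
      exact (hout i hd).1
    obtain ⟨d', rfl⟩ := exists_iotaD v d h1 h2
    by_cases h3 : ∀ j, d' ≠ gam j
    · refine (bigL_com X Γ Y big' ⟨d', h3⟩).2 (hcpt'.outer_big d' ?_)
      rw [← ho']
      exact (hface d'.symm d0').2 (Or.inl (hd.trans ho.symm))
    · push Not at h3
      obtain ⟨j, rfl⟩ := h3
      rw [bigL_gam E X Γ Y big' hgam]
      rw [faceN_gam E v _ _ (hgam _)] at hd
      exact (hout j hd).2.1
  · exact bigL_one E X Γ Y big' hgam hX hΓ hXΓ hY hcpt'.one_big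

end Helpers6

/-- **Lemma 5.** Let `v` be a vertex of degree two in a Laman spanning subgraph of the plane
graph `G`, and suppose `G ∖ v` is generically rigid.  Then every CPT-labelling of `G ∖ v`
(w.r.t. its induced plane embedding) with the generalized Laman property extends to a
CPT-labelling of `G` with the generalized Laman property. -/
theorem degree_two_vertex_cpt_labelling_extension
    {V : Type} [Fintype V] [DecidableEq V] (G : SimpleGraph V)
    (E : PlaneEmb G) (v : V)
    (L : SimpleGraph V) (hLG : L ≤ G) (hLaman : LamanGraph L)
    (hdeg : Nat.card (L.neighborSet v) = 2)
    (hrig : GenRigid (G.induce ({v}ᶜ : Set V)))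
    (E' : PlaneEmb (G.induce ({v}ᶜ : Set V))) (hind : IsInducedPlaneEmbDel G v E E')
    (big' : (G.induce ({v}ᶜ : Set V)).Dart → Prop)
    (hcpt' : IsCPTLabelling E' big') (hgl' : GenLaman (G.induce ({v}ᶜ : Set V)) big') :
    ∃ big : G.Dart → Prop, IsCPTLabelling E big ∧ GenLaman G big ∧
      ExtendsDelLabel G v E E' big big' := by
  classical
  have h := two_le_ndart L hLG hdeg
  choose gam hgam using exists_gam E h E'.connected
  obtain ⟨hinj, hface, hsurj⟩ := faces_struct E h hind
  obtain ⟨-, d0', d0, hd0, ho', ho⟩ := id hind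
  rw [delCorr_iff] at hd0
  subst hd0
  by_cases hA : E.outer ∈ Set.range (faceN E v)
  · obtain ⟨i0, hi0⟩ := hA
    obtain ⟨j0, rfl⟩ := (tauP E v).surjective i0
    have hbig : ∀ d', E.angleFace (iotaD v d') ∈ Set.range (faceN E v) → big' d' := by
      intro d' hd'
      apply hcpt'.outer_big
      rw [← ho']
      refine (hface d'.symm d0').2 (Or.inr ⟨hd', ?_⟩)
      rw [ho]; exact ⟨_, hi0⟩
    have hbg : ∀ j, big' (gam j) := fun j => hbig _ ⟨_, (faceN_gam E v _ _ (hgam j)).symm⟩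
    refine cpt_finish E h hind hgam (fun j => decide (j = tauP E v j0)) (fun j => decide (j = j0))
      (fun j => decide (j = j0)) big' hcpt' hgl' (fun j _ => hbg j) (fun j _ => hbg j) ?_ ?_ ?_ ?_ ?_
    · intro j hj
      simp only [decide_eq_true_eq] at hj
      exact tauP_ne E h j0 (hj.1.symm.trans hj.2)
    · intro i j hi hj
      simp only [decide_eq_true_eq] at hi hj
      rw [hi, hj]
    · have e1 : {j | ¬ big' (gam j) ∨ decide (j = tauP E v j0) = true ∨ decide (j = j0) = true}
          = {tauP E v j0, j0} := by
        ext j; simp [hbg j]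
      have e2 : {j | decide (j = j0) = true} = {j0} := by
        ext j; simp
      rw [e1, e2, Nat.card_coe_set_eq, Nat.card_coe_set_eq, Set.ncard_singleton]
      rw [Set.ncard_pair (tauP_ne E h j0)]
    · intro j hj
      have hjj : j ≠ j0 := by rintro rfl; exact hj hi0
      have ht : tCount E gam big' j = 0 := by
        unfold tCount
        have : {d' : DCom gam | E.angleFace (iotaD v d'.1) = faceN E v (tauP E v j) ∧
            ¬ big' d'.1} = ∅ := by
          ext d'
          simp only [Set.mem_setOf_eq, Set.mem_empty_iff_false, iff_false]
          rintro ⟨h1, h2⟩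
          exact h2 (hbig _ ⟨_, h1.symm⟩)
        rw [this]; simp
      rw [ht]
      simp [hjj]
    · intro j hj
      have : j = j0 := (tauP E v).injective (hinj (hj.trans hi0.symm))
      simp [this]
  · obtain ⟨i0, -⟩ := id h
    obtain ⟨e', he'⟩ := hsurj (faceN E v i0)
    have hne' : E'.dartFace e' ≠ E'.outer := by
      rw [← ho']
      intro hh
      apply hA
      rcases (hface _ _).1 hh with h1 | h1
      · exact ⟨i0, by rw [← he', h1, ho]⟩
      · rw [← ho]; exact h1.2
    have h3 := hcpt'.bounded_small _ hne'
    rw [card_D' E hgam (fun d => E'.angleFace d = E'.dartFace e' ∧ ¬ big' d)] at h3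
    have hiff : ∀ d', E'.angleFace d' = E'.dartFace e' ↔
        E.angleFace (iotaD v d') ∈ Set.range (faceN E v) := by
      intro d'
      refine (hface d'.symm e').trans ?_
      rw [he']
      constructor
      · rintro (h1 | h1)
        · exact ⟨i0, h1.symm⟩
        · exact h1.1
      · intro h1; exact Or.inr ⟨h1, ⟨i0, rfl⟩⟩
    have hgA : ∀ j, E.angleFace (iotaD v (gam j)) ∈ Set.range (faceN E v) :=
      fun j => ⟨_, (faceN_gam E v _ _ (hgam j)).symm⟩
    simp only [hiff, hgA, true_and] at h3
    have : Fintype (NDart G v) := Fintype.ofFinite _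
    have hsum : Nat.card {d' : DCom gam | E.angleFace (iotaD v d'.1) ∈ Set.range (faceN E v) ∧
        ¬ big' d'.1} = ∑ j, tCount E gam big' j := by
      unfold tCount
      rw [← Nat.card_sigma]
      refine (Nat.card_congr (Equiv.ofBijective
        (fun x => ⟨x.2.1, ⟨_, x.2.2.1.symm⟩, x.2.2.2⟩) ⟨?_, ?_⟩)).symm
      · rintro ⟨i, d, h1, h2⟩ ⟨j, e, h3, h4⟩ hh
        have hde : d = e := congrArg Subtype.val hh
        subst hde
        have : i = j := (tauP E v).injective (hinj (h1.symm.trans h3))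
        subst this
        rfl
      · rintro ⟨d, ⟨i, hi⟩, h2⟩
        obtain ⟨j, rfl⟩ := (tauP E v).surjective i
        exact ⟨⟨j, d, hi.symm, h2⟩, rfl⟩
    rw [hsum] at h3
    have hcc : Nat.card {j | ¬ big' (gam j)} =
        (Finset.univ.filter (fun j => ¬ big' (gam j))).card := by
      rw [Nat.card_eq_fintype_card, Fintype.card_subtype]
      simp
    rw [hcc] at h3
    obtain ⟨X, Γ, Y, hX, hΓ, hXΓ, hY, ht⟩ := cpt_distribute (tauP E v) (tauP_ne E h)
      (tCount E gam big') (fun j => ¬ big' (gam j)) (by omega)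
    refine cpt_finish E h hind hgam X Γ Y big' hcpt' hgl' (fun j hj => not_not.1 (hX j hj))
      (fun j hj => not_not.1 (hΓ j hj)) hXΓ hY ?_ (fun j _ => ht j)
      (fun j hj => absurd ⟨_, hj⟩ hA)
    have hb : ∀ b : NDart G v → Bool, ({j | b j = true}).ncard = ∑ j, (b j).toNat := by
      intro b
      rw [Set.ncard_eq_toFinset_card', Set.toFinset_setOf, Finset.card_filter]
      apply Finset.sum_congr rfl
      intro j _
      cases b j <;> rfl
    have hs : ∑ j, tCount E gam big' j = ∑ j, (X j).toNat + ∑ j, (Γ j).toNat + ∑ j, (Y j).toNat := by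
      rw [← Equiv.sum_comp (tauP E v) (fun j => (X j).toNat), ← Finset.sum_add_distrib,
        ← Finset.sum_add_distrib]
      exact Finset.sum_congr rfl (fun j _ => (ht j).symm)
    have hu : ({j | ¬ big' (gam j) ∨ X j = true ∨ Γ j = true}).ncard ≤
        ({j | ¬ big' (gam j)}).ncard + (({j | X j = true}).ncard + ({j | Γ j = true}).ncard) := by
      refine (Set.ncard_union_le {j | ¬ big' (gam j)} ({j | X j = true} ∪ {j | Γ j = true})).trans ?_
      have := Set.ncard_union_le {j | X j = true} {j | Γ j = true}
      omega
    rw [Nat.card_coe_set_eq] at hcc ⊢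
    rw [Nat.card_coe_set_eq]
    rw [hb X, hb Γ] at hu
    rw [hb Y]
    omega
end

section
/- Let G be a graph embedded on a closed surface S of genus g, and suppose G admits a combinatorial pseudo-triangular angle assignment (every face has exactly three small angles and every vertex has at most one big angle). Let e, x and y be the numbers of edges, non-pointed vertices and pointed vertices of G. Then e = 3x + 2y − 6 + 6g if S is orientable, and e = 3x + 2y − 6 + 3g if S is non-orientable. -/
/-- A combinatorial embedding of a graph `G` on a closed surface: a rotation system (the
cyclic order of darts around each vertex), together with an abstract set of faces and an
assignment sending each angle (recorded by a dart: the corner at `d.fst` between the edges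
of `d` and of the next dart in the rotation) to the face containing it.  On a closed surface
there is no outer face. -/
structure SurfaceMap {V : Type} (G : SimpleGraph V) where
  rot : Equiv.Perm G.Dart
  rot_fst : ∀ d : G.Dart, (rot d).fst = d.fst
  rot_vertex : ∀ d d' : G.Dart, d.fst = d'.fst → ∃ n : ℕ, (rot ^ n) d = d'
  Face : Type
  angleFace : G.Dart → Face
  face_surj : Function.Surjective angleFace

/-- **Proposition 1.** Let `G` be embedded on a closed surface `S` of genus `g` and suppose
`G` has a combinatorial pseudo-triangular assignment of angles (every face has exactly three
small angles, every vertex at most one big angle).  If `e`, `x`, `y` are the numbers of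
edges, non-pointed and pointed vertices, then `e = 3x + 2y - 6 + 6g` when `S` is orientable
(Euler characteristic `2 - 2g`), and `e = 3x + 2y - 6 + 3g` when `S` is non-orientable
(Euler characteristic `2 - g`). -/
theorem surface_cpt_edge_count
    {V : Type} [Fintype V] [DecidableEq V] (G : SimpleGraph V)
    (M : SurfaceMap G) (g : ℕ) (big : G.Dart → Prop)
    (hsmall : ∀ F : M.Face, Nat.card {d : G.Dart | M.angleFace d = F ∧ ¬ big d} = 3)
    (hone : ∀ d d' : G.Dart, big d → big d' → d.fst = d'.fst → d = d') :
    (((Nat.card V : ℤ) - Nat.card G.edgeSet + Nat.card M.Face = 2 - 2 * g) →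
      (Nat.card G.edgeSet : ℤ) =
        3 * Nat.card {v : V | ¬ PointedVx big v} + 2 * Nat.card {v : V | PointedVx big v}
          - 6 + 6 * g) ∧
    (((Nat.card V : ℤ) - Nat.card G.edgeSet + Nat.card M.Face = 2 - g) →
      (Nat.card G.edgeSet : ℤ) =
        3 * Nat.card {v : V | ¬ PointedVx big v} + 2 * Nat.card {v : V | PointedVx big v}
          - 6 + 3 * g) := by
  classical
  haveI : Finite M.Face := Finite.of_surjective _ M.face_surj
  haveI : Fintype M.Face := Fintype.ofFinite _
  have h2 : Nat.card G.Dart = 2 * Nat.card G.edgeSet := by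
    rw [Nat.card_eq_fintype_card, G.dart_card_eq_twice_card_edges, Nat.card_eq_fintype_card,
      SimpleGraph.edgeFinset_card]
  have hsplit : Nat.card {d : G.Dart // big d} + Nat.card {d : G.Dart // ¬ big d}
      = Nat.card G.Dart := by
    rw [← Nat.card_sum]
    exact Nat.card_congr (Equiv.sumCompl _)
  have hV : Nat.card {v : V // PointedVx big v} + Nat.card {v : V // ¬ PointedVx big v}
      = Nat.card V := by
    rw [← Nat.card_sum]
    exact Nat.card_congr (Equiv.sumCompl _)
  have hbig : Nat.card {d : G.Dart // big d} = Nat.card {v : V // PointedVx big v} := by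
    refine Nat.card_congr (Equiv.ofBijective
      (fun d => (⟨d.1.fst, d.1, d.2, rfl⟩ : {v : V // PointedVx big v})) ⟨?_, ?_⟩)
    · intro a b h
      exact Subtype.ext (hone _ _ a.2 b.2 (congrArg Subtype.val h))
    · rintro ⟨v, d, hd, rfl⟩
      exact ⟨⟨d, hd⟩, rfl⟩
  have hsm : Nat.card {d : G.Dart // ¬ big d} = 3 * Nat.card M.Face := by
    have e : {d : G.Dart // ¬ big d} ≃
        (Σ F : M.Face, {d : G.Dart | M.angleFace d = F ∧ ¬ big d}) :=
      { toFun := fun d => ⟨M.angleFace d.1, d.1, rfl, d.2⟩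
        invFun := fun s => ⟨s.2.1, s.2.2.2⟩
        left_inv := fun d => rfl
        right_inv := by
          rintro ⟨F, d, rfl, hd⟩
          rfl }
    rw [Nat.card_congr e, Nat.card_sigma]
    simp only [hsmall, Finset.sum_const, Finset.card_univ, smul_eq_mul,
      Nat.card_eq_fintype_card]
    ring
  change ((_ → (Nat.card G.edgeSet : ℤ) = 3 * Nat.card {v : V // ¬ PointedVx big v}
      + 2 * Nat.card {v : V // PointedVx big v} - 6 + 6 * g) ∧
    (_ → (Nat.card G.edgeSet : ℤ) = 3 * Nat.card {v : V // ¬ PointedVx big v}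
      + 2 * Nat.card {v : V // PointedVx big v} - 6 + 3 * g))
  constructor <;> intro h <;> omega
end

section
/- Every plane graph that is generically rigid in the plane admits a CPT-labelling (not necessarily with the generalized Laman property): one can start with a CPT-labelling of a minimally rigid spanning subgraph in which every vertex is pointed, and insert the remaining edges one at a time, relabelling only angles of the subdivided face, losing at most one pointed vertex per inserted edge. -/
theorem exists_generic (V : Type) [Fintype V] : ∃ p : V → ℝ × ℝ, GenericConf p := by
  obtain ⟨s, hs⟩ := exists_isTranscendenceBasis ℚ ℝ
  have hinf : Infinite s := by
    by_contra hfin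
    rw [not_infinite_iff_finite] at hfin
    have := hs.isAlgebraic
    have h1 := Algebra.IsAlgebraic.cardinalMk_le_max (Algebra.adjoin ℚ (Set.range ((↑) : s → ℝ))) ℝ
    have h2 : Cardinal.mk (Algebra.adjoin ℚ (Set.range ((↑) : s → ℝ))) ≤ Cardinal.aleph0 := by
      have : Countable (Algebra.adjoin ℚ (Set.range ((↑) : s → ℝ))) := by
        have hle : Cardinal.mk (MvPolynomial s ℚ) ≤ Cardinal.aleph0 :=
          MvPolynomial.cardinalMk_le_max.trans
            (max_le (max_le Cardinal.mk_le_aleph0 Cardinal.mk_le_aleph0) le_rfl)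
        have := Cardinal.mk_le_aleph0_iff.1 hle
        exact hs.1.aevalEquiv.symm.injective.countable
      exact Cardinal.mk_le_aleph0
    rw [Cardinal.mk_real] at h1
    have := h1.trans (max_le h2 le_rfl)
    exact absurd Cardinal.aleph0_lt_continuum (not_lt.mpr this)
  let g : V ⊕ V ↪ s := (Fintype.equivFin (V ⊕ V)).toEmbedding.trans
    (Fin.valEmbedding.trans (Infinite.natEmbedding s))
  refine ⟨fun v => ((g (Sum.inl v) : ℝ), (g (Sum.inr v) : ℝ)), ?_⟩
  have := hs.1.comp g g.injective
  unfold GenericConf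
  convert this using 1
  ext x
  cases x <;> rfl

theorem rigid_count {V ι κ : Type} [Fintype V] [Fintype ι] [Fintype κ] (G : SimpleGraph V)
    (hrig : GenRigid G) (W : ι → Finset V) (a b : κ → V)
    (hcov : ∀ u v, G.Adj u v → (∃ k, (a k = u ∧ b k = v) ∨ (a k = v ∧ b k = u)) ∨
      ∃ i, u ∈ W i ∧ v ∈ W i)
    (hW : ∀ i, ∃ u ∈ W i, ∃ v ∈ W i, u ≠ v) :
    2 * Fintype.card V + 3 * Fintype.card ι ≤ 3 + Fintype.card κ + 2 * ∑ i, (W i).card := by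
  obtain ⟨p, hp⟩ := exists_generic V
  have hr := hrig p hp
  have hinj : ∀ u v, p u = p v → u = v := by
    intro u v h
    have h2 : (Sum.inl u : V ⊕ V) = Sum.inl v := hp.injective (by simp [h])
    exact Sum.inl.inj h2
  let Φ : ((V → ℝ × ℝ) × (ι → ℝ × (ℝ × ℝ))) →ₗ[ℝ]
      ((κ → ℝ) × ((x : Σ i, {v // v ∈ W i}) → ℝ × ℝ)) :=
    { toFun := fun q => (fun k => dot2 (p (a k) - p (b k)) (q.1 (a k) - q.1 (b k)),
        fun x => q.1 x.2.1 - ((q.2 x.1).1 • rot90 (p x.2.1) + (q.2 x.1).2))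
      map_add' := by
        intro x y
        refine Prod.ext ?_ ?_
        · funext k; simp [dot2]; ring
        · funext k; refine Prod.ext ?_ ?_ <;> simp <;> ring
      map_smul' := by
        intro c x
        refine Prod.ext ?_ ?_
        · funext k; simp [dot2]; ring
        · funext k; refine Prod.ext ?_ ?_ <;> simp <;> ring }
  let T : (ℝ × (ℝ × ℝ)) →ₗ[ℝ] ((V → ℝ × ℝ) × (ι → ℝ × (ℝ × ℝ))) :=
    { toFun := fun t => (fun v => t.1 • rot90 (p v) + t.2, fun _ => t)
      map_add' := by
        intro x y
        refine Prod.ext ?_ ?_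
        · funext k; refine Prod.ext ?_ ?_ <;> simp <;> ring
        · funext k; rfl
      map_smul' := by
        intro c x
        refine Prod.ext ?_ ?_
        · funext k; refine Prod.ext ?_ ?_ <;> simp <;> ring
        · funext k; rfl }
  have hker : LinearMap.ker Φ ≤ LinearMap.range T := by
    rintro ⟨q, t⟩ hq
    rw [LinearMap.mem_ker] at hq
    have hk : ∀ k, dot2 (p (a k) - p (b k)) (q (a k) - q (b k)) = 0 :=
      fun k => congrFun (congrArg Prod.fst hq) k
    have hw : ∀ i, ∀ v ∈ W i, q v = (t i).1 • rot90 (p v) + (t i).2 :=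
      fun i v hv => sub_eq_zero.mp (congrFun (congrArg Prod.snd hq) ⟨i, ⟨v, hv⟩⟩)
    have hm : IsInfMotion G p q := by
      intro u v huv
      rcases hcov u v huv with ⟨k, ⟨h1, h2⟩ | ⟨h1, h2⟩⟩ | ⟨i, hu, hv⟩
      · rw [← h1, ← h2]; exact hk k
      · have := hk k
        rw [h1, h2] at this
        simp only [dot2, Prod.fst_sub, Prod.snd_sub] at this ⊢
        linarith
      · rw [hw i u hu, hw i v hv]
        simp [dot2, rot90]; ring
    obtain ⟨α, s, hs⟩ := hr q hm
    refine ⟨(α, s), ?_⟩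
    refine Prod.ext ?_ ?_
    · funext v; exact (hs v).symm
    · funext i
      obtain ⟨u, hu, v, hv, huv⟩ := hW i
      have e1 := (hw i u hu).symm.trans (hs u)
      have e2 := (hw i v hv).symm.trans (hs v)
      have hne : p u ≠ p v := fun h => huv (hinj _ _ h)
      simp only [Prod.ext_iff, rot90, Prod.fst_add, Prod.snd_add, Prod.smul_fst, Prod.smul_snd,
        smul_eq_mul] at e1 e2
      have hα : α = (t i).1 := by
        by_contra hc
        apply hne
        have hc' : α - (t i).1 ≠ 0 := sub_ne_zero.mpr hc
        refine Prod.ext ?_ ?_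
        · apply mul_left_cancel₀ hc'; linarith [e1.2, e2.2]
        · apply mul_left_cancel₀ hc'; linarith [e1.1, e2.1]
      refine Prod.ext hα (Prod.ext ?_ ?_)
      · show s.1 = (t i).2.1
        rw [← hα] at e1; linarith [e1.1]
      · show s.2 = (t i).2.2
        rw [← hα] at e1; linarith [e1.2]
  have h1 := LinearMap.finrank_range_add_finrank_ker Φ
  have h2 := Submodule.finrank_mono hker
  have h3 := LinearMap.finrank_range_le T
  have h4 := Submodule.finrank_le (LinearMap.range Φ)
  simp [Module.finrank_pi_fintype, Finset.sum_const, Fintype.card_sigma] at h1 h2 h3 h4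
  omega

theorem euler_count {V : Type} [Fintype V] {G : SimpleGraph V} [Fintype G.Dart]
    (hc : G.Connected) {Fc : Type} [Fintype Fc] (rot : Equiv.Perm G.Dart)
    (hrot : ∀ d, (rot d).fst = d.fst) (f : G.Dart → Fc)
    (hf : ∀ d, f (rot d) = f d.symm) (hsurj : Function.Surjective f)
    (P : Fc → Prop) [DecidablePred P] (hP : ∃ F, P F)
    (U : V → Prop) [DecidablePred U] (hU : ∀ v, U v ↔ ∀ d : G.Dart, d.fst = v → ¬ P (f d))
    (κ : Type) [Fintype κ] (dt : κ → G.Dart)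
    (hdt : ∀ d, ¬ P (f d) → ¬ P (f d.symm) → ∃ k, dt k = d ∨ dt k = d.symm)
    (r : {F // ¬ P F} → {F // ¬ P F} → Prop)
    (hr : ∀ x y, r x y ↔ ∃ d, f d = x.1 ∧ f d.symm = y.1) [Fintype (Quot r)] :
    Fintype.card {v // U v} + Fintype.card {F // ¬ P F} ≤
      Fintype.card κ + Fintype.card (Quot r) := by
  let ec : ({v // U v} → ℝ) → V → ℝ := fun c v => if h : U v then c ⟨v, h⟩ else 0
  let eg : ({F // ¬ P F} → ℝ) → Fc → ℝ := fun g F => if h : ¬ P F then g ⟨F, h⟩ else 0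
  have ec_add : ∀ c c' v, ec (c + c') v = ec c v + ec c' v := by
    intro c c' v; simp only [ec]; split_ifs <;> simp
  have eg_add : ∀ c c' v, eg (c + c') v = eg c v + eg c' v := by
    intro c c' v; simp only [eg]; split_ifs <;> simp
  have ec_smul : ∀ (s : ℝ) c v, ec (s • c) v = s * ec c v := by
    intro s c v; simp only [ec]; split_ifs <;> simp
  have eg_smul : ∀ (s : ℝ) c v, eg (s • c) v = s * eg c v := by
    intro s c v; simp only [eg]; split_ifs <;> simp
  let Φ : (({v // U v} → ℝ) × ({F // ¬ P F} → ℝ)) →ₗ[ℝ] (κ → ℝ) :=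
    { toFun := fun q k => (ec q.1 (dt k).fst - ec q.1 (dt k).snd) +
        (eg q.2 (f (dt k)) - eg q.2 (f (dt k).symm))
      map_add' := by
        intro x y; funext k; simp only [Prod.fst_add, Prod.snd_add, ec_add, eg_add, Pi.add_apply]; ring
      map_smul' := by
        intro s y; funext k
        simp only [Prod.smul_fst, Prod.smul_snd, ec_smul, eg_smul, Pi.smul_apply, smul_eq_mul,
          RingHom.id_apply]; ring }
  let T : (Quot r → ℝ) →ₗ[ℝ] (({v // U v} → ℝ) × ({F // ¬ P F} → ℝ)) :=
    { toFun := fun t => (0, fun F => t (Quot.mk r F))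
      map_add' := by intro x y; ext <;> simp
      map_smul' := by intro x y; ext <;> simp }
  -- an edge with an endpoint in U has no side in P
  have hUs : ∀ d : G.Dart, U d.fst → ¬ P (f d) ∧ ¬ P (f d.symm) := by
    intro d hd
    refine ⟨(hU _).1 hd d rfl, ?_⟩
    rw [← hf]; exact (hU _).1 hd _ (hrot d)
  have hker : LinearMap.ker Φ ≤ LinearMap.range T := by
    rintro ⟨c, g⟩ hq
    rw [LinearMap.mem_ker] at hq
    have hk : ∀ k, (ec c (dt k).fst - ec c (dt k).snd) +
        (eg g (f (dt k)) - eg g (f (dt k).symm)) = 0 := fun k => congrFun hq k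
    have hd : ∀ d, ¬ P (f d) → ¬ P (f d.symm) → (ec c d.fst - ec c d.snd) +
        (eg g (f d) - eg g (f d.symm)) = 0 := by
      intro d h1 h2
      obtain ⟨k, h | h⟩ := hdt d h1 h2
      · rw [← h]; exact hk k
      · have := hk k
        rw [h, SimpleGraph.Dart.symm_symm] at this
        have t1 : d.symm.fst = d.snd := rfl
        have t2 : d.symm.snd = d.fst := rfl
        rw [t1, t2] at this
        linarith
    have horth : ∑ d : G.Dart, (ec c d.fst - ec c d.snd) * (eg g (f d) - eg g (f d.symm)) = 0 := by
      have s1 : ∑ d : G.Dart, ec c d.fst * eg g (f d.symm) = ∑ d : G.Dart, ec c d.fst * eg g (f d) := by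
        rw [← Equiv.sum_comp rot (fun d => ec c d.fst * eg g (f d))]
        refine Finset.sum_congr rfl fun d _ => ?_
        rw [hrot, hf]
      have s2 : ∑ d : G.Dart, ec c d.snd * eg g (f d.symm) = ∑ d : G.Dart, ec c d.fst * eg g (f d) := by
        rw [← Equiv.sum_comp (dartSymmPerm G) (fun d => ec c d.fst * eg g (f d))]
        rfl
      have s3 : ∑ d : G.Dart, ec c d.snd * eg g (f d) = ∑ d : G.Dart, ec c d.fst * eg g (f d.symm) := by
        rw [← Equiv.sum_comp (dartSymmPerm G) (fun d => ec c d.fst * eg g (f d.symm))]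
        refine Finset.sum_congr rfl fun d _ => ?_
        simp [dartSymmPerm]
      simp only [sub_mul, mul_sub, Finset.sum_sub_distrib]
      rw [s3, s2, s1]; ring
    have hzero : ∀ d : G.Dart, ec c d.fst = ec c d.snd := by
      have hle : ∀ d ∈ (Finset.univ : Finset G.Dart),
          0 ≤ -((ec c d.fst - ec c d.snd) * (eg g (f d) - eg g (f d.symm))) ∧
          -((ec c d.fst - ec c d.snd) * (eg g (f d) - eg g (f d.symm))) =
            (ec c d.fst - ec c d.snd) ^ 2 := by
        intro d _
        by_cases h : ¬ P (f d) ∧ ¬ P (f d.symm)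
        · have := hd d h.1 h.2
          have h2 : eg g (f d) - eg g (f d.symm) = -(ec c d.fst - ec c d.snd) := by linarith
          rw [h2]
          constructor <;> nlinarith [sq_nonneg (ec c d.fst - ec c d.snd)]
        · have h1 : ¬ U d.fst := fun hu => h (hUs d hu)
          have h2 : ¬ U d.snd := fun hu => h (by
            have := hUs d.symm hu
            rw [SimpleGraph.Dart.symm_symm] at this
            exact this.symm)
          simp [ec, h1, h2]
      have hs : ∑ d : G.Dart, -((ec c d.fst - ec c d.snd) * (eg g (f d) - eg g (f d.symm))) = 0 := by
        rw [Finset.sum_neg_distrib, horth, neg_zero]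
      rw [Finset.sum_eq_zero_iff_of_nonneg (fun d hd => (hle d hd).1)] at hs
      intro d
      have := hs d (Finset.mem_univ _)
      rw [(hle d (Finset.mem_univ _)).2] at this
      exact sub_eq_zero.mp (pow_eq_zero_iff (two_ne_zero) |>.1 this)
    have hec : ∀ v, ec c v = 0 := by
      obtain ⟨F, hF⟩ := hP
      obtain ⟨d0, rfl⟩ := hsurj F
      have h0 : ec c d0.fst = 0 := by
        have : ¬ U d0.fst := fun hu => (hU _).1 hu d0 rfl hF
        simp [ec, this]
      intro v
      generalize d0.fst = x at h0
      obtain ⟨w⟩ := hc.preconnected v x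
      induction w with
      | nil => exact h0
      | cons h w ih => exact (hzero ⟨(_, _), h⟩).trans (ih h0)
    have hc0 : c = 0 := by
      funext v
      have := hec v.1
      simpa [ec, v.2] using this
    have hg : ∀ x y, r x y → g x = g y := by
      intro x y hxy
      obtain ⟨d, h1, h2⟩ := (hr x y).1 hxy
      have := hd d (h1 ▸ x.2) (h2 ▸ y.2)
      rw [hec, hec, h1, h2] at this
      simp [eg, x.2, y.2] at this
      linarith
    refine ⟨Quot.lift g hg, ?_⟩
    rw [hc0]
    rfl
  have h1 := LinearMap.finrank_range_add_finrank_ker Φ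
  have h2 := Submodule.finrank_mono hker
  have h3 := LinearMap.finrank_range_le T
  have h4 := Submodule.finrank_le (LinearMap.range Φ)
  simp only [Module.finrank_prod, Module.finrank_fintype_fun_eq_card] at h1 h2 h3 h4
  omega

theorem dart_sum {V : Type} {G : SimpleGraph V} [Fintype G.Dart] [Fintype G.edgeSet]
    (dt : G.edgeSet → G.Dart) (hdt : ∀ e, (dt e).edge = e.1) (g : G.Dart → ℕ) :
    ∑ d, g d = ∑ e, (g (dt e) + g (dt e).symm) := by
  classical
  rw [← Finset.sum_fiberwise (s := Finset.univ) (g := fun d : G.Dart => (⟨d.edge, d.edge_mem⟩ : G.edgeSet))]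
  refine Finset.sum_congr rfl fun e _ => ?_
  have : Finset.univ.filter (fun d : G.Dart => (⟨d.edge, d.edge_mem⟩ : G.edgeSet) = e)
      = {dt e, (dt e).symm} := by
    ext d
    simp only [Finset.mem_filter, Finset.mem_univ, true_and, Finset.mem_insert,
      Finset.mem_singleton, ← SimpleGraph.dart_edge_eq_iff, hdt, Subtype.ext_iff]
  rw [this, Finset.sum_pair (SimpleGraph.Dart.symm_ne _).symm]

theorem hall_count {V : Type} [Fintype V] (G : SimpleGraph V) (E : PlaneEmb G)
    (hrig : GenRigid G) (P : E.Face → Prop) (hP : ∃ F, P F) :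
    Nat.card {d : G.Dart // P (E.dartFace d)} + 3 ≤
      Nat.card {v : V // ∃ d : G.Dart, d.fst = v ∧ P (E.dartFace d)} + 3 * Nat.card {F // P F} := by
  classical
  set f : G.Dart → E.Face := E.dartFace with hfdef
  have hf : ∀ d, f (E.rot d) = f d.symm := by
    intro d
    refine Quotient.sound ?_
    refine Equiv.Perm.SameCycle.symm ⟨1, ?_⟩
    simp [dartSymmPerm]
  have hsurj : Function.Surjective f := Quotient.mk_surjective
  have : Fintype E.Face := Fintype.ofFinite _
  let U : V → Prop := fun v => ∀ d : G.Dart, d.fst = v → ¬ P (f d)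
  have hex : ∀ e : G.edgeSet, ∃ d : G.Dart, d.edge = e.1 := by
    rintro ⟨e, he⟩
    induction e using Sym2.ind with
    | _ u v => exact ⟨⟨(u, v), he⟩, rfl⟩
  choose dt hdt using hex
  have hdt' : ∀ d : G.Dart, dt ⟨d.edge, d.edge_mem⟩ = d ∨ dt ⟨d.edge, d.edge_mem⟩ = d.symm := by
    intro d
    rw [← SimpleGraph.dart_edge_eq_iff, hdt]
  let r : {F // ¬ P F} → {F // ¬ P F} → Prop := fun x y => ∃ d, f d = x.1 ∧ f d.symm = y.1
  have : Fintype (Quot r) := Fintype.ofFinite _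
  let κ0 := {e : G.edgeSet // ¬ P (f (dt e)) ∧ ¬ P (f (dt e).symm)}
  let κ2 := {e : G.edgeSet // P (f (dt e)) ∧ P (f (dt e).symm)}
  have E1 : Fintype.card {v // U v} + Fintype.card {F // ¬ P F} ≤
      Fintype.card κ0 + Fintype.card (Quot r) := by
    refine euler_count E.connected E.rot E.rot_fst f hf hsurj P hP U (fun v => Iff.rfl) κ0
      (fun k => dt k.1) ?_ r (fun x y => Iff.rfl)
    intro d h1 h2
    refine ⟨⟨⟨d.edge, d.edge_mem⟩, ?_⟩, hdt' d⟩
    rcases hdt' d with h | h <;> rw [h]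
    · exact ⟨h1, h2⟩
    · rw [SimpleGraph.Dart.symm_symm]; exact ⟨h2, h1⟩
  let hole : Quot r → V → G.Dart → Prop := fun i v d => d.fst = v ∧ ∃ h : ¬ P (f d), Quot.mk r ⟨f d, h⟩ = i
  let W : Quot r → Finset V := fun i => Finset.univ.filter fun v => ∃ d, hole i v d
  have hstep : ∀ i v d, hole i v d → ¬ P (f (E.rot d)) → hole i v (E.rot d) := by
    rintro i v d ⟨h1, h2, h3⟩ h4
    refine ⟨(E.rot_fst d).trans h1, h4, ?_⟩
    rw [← h3]
    exact (Quot.sound ⟨d, rfl, (hf d).symm⟩).symm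
  have hends : ∀ d (h : ¬ P (f d)), d.fst ∈ W (Quot.mk r ⟨f d, h⟩) ∧ d.snd ∈ W (Quot.mk r ⟨f d, h⟩) := by
    intro d h
    have e : f (E.rot d.symm) = f d := by rw [hf, SimpleGraph.Dart.symm_symm]
    simp only [W, Finset.mem_filter, Finset.mem_univ, true_and]
    refine ⟨⟨d, rfl, h, rfl⟩, ⟨E.rot d.symm, E.rot_fst _, by rw [e]; exact h, ?_⟩⟩
    congr 1
    exact Subtype.ext e
  have E2 : 2 * Fintype.card V + 3 * Fintype.card (Quot r) ≤
      3 + Fintype.card κ2 + 2 * ∑ i, (W i).card := by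
    refine rigid_count G hrig W (fun k : κ2 => (dt k.1).fst) (fun k => (dt k.1).snd) ?_ ?_
    · intro u v huv
      let d : G.Dart := ⟨(u, v), huv⟩
      by_cases h1 : P (f d)
      · by_cases h2 : P (f d.symm)
        · left
          refine ⟨⟨⟨d.edge, d.edge_mem⟩, ?_⟩, ?_⟩
          · rcases hdt' d with h | h <;> rw [h]
            · exact ⟨h1, h2⟩
            · rw [SimpleGraph.Dart.symm_symm]; exact ⟨h2, h1⟩
          · rcases hdt' d with h | h
            · left; simp only [h]; exact ⟨rfl, rfl⟩
            · right; simp only [h]; exact ⟨rfl, rfl⟩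
        · right
          exact ⟨_, (hends d.symm h2).2, (hends d.symm h2).1⟩
      · right
        exact ⟨_, (hends d h1).1, (hends d h1).2⟩
    · intro i
      induction i using Quot.ind with
      | _ F =>
        obtain ⟨F, hF⟩ := F
        obtain ⟨d, rfl⟩ := hsurj F
        exact ⟨_, (hends d hF).1, _, (hends d hF).2, d.fst_ne_snd⟩
  let D1 := {d : G.Dart // ¬ P (f d) ∧ P (f d.symm)}
  have E3 : ∑ i, (W i).card ≤ Fintype.card {v // U v} + Fintype.card D1 := by
    have hs : ∑ i, (W i).card = Fintype.card (Σ i, {v // v ∈ W i}) := by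
      simp [Fintype.card_sigma]
    rw [hs, ← Fintype.card_sum]
    have key : ∀ x : Σ i, {v // v ∈ W i}, ¬ U x.2.1 → ∃ d, hole x.1 x.2.1 d ∧ P (f (E.rot d)) := by
      rintro ⟨i, v, hv⟩ hu
      simp only [W, Finset.mem_filter, Finset.mem_univ, true_and] at hv
      obtain ⟨d, hd⟩ := hv
      simp only [U, not_forall, not_not] at hu
      obtain ⟨d', hd', hPd'⟩ := hu
      by_contra hcon
      push Not at hcon
      have hall : ∀ n : ℕ, hole i v ((E.rot ^ n) d) := by
        intro n
        induction n with
        | zero => exact hd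
        | succ n ih =>
          rw [pow_succ']
          exact hstep _ _ _ ih (hcon _ ih)
      obtain ⟨n, hn⟩ := E.rot_vertex d d' (hd.1.trans hd'.symm)
      have := hall n
      rw [hn] at this
      exact this.2.1 hPd'
    have : Nonempty G.Dart := by
      obtain ⟨F, _⟩ := hP
      exact ⟨(hsurj F).choose⟩
    choose! kd hkd using key
    have uniq : ∀ v, U v → ∀ i j, v ∈ W i → v ∈ W j → i = j := by
      intro v hu i j hi hj
      simp only [W, Finset.mem_filter, Finset.mem_univ, true_and] at hi hj
      obtain ⟨d, hd⟩ := hi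
      obtain ⟨d', hd'⟩ := hj
      have hall : ∀ n : ℕ, hole i v ((E.rot ^ n) d) := by
        intro n
        induction n with
        | zero => exact hd
        | succ n ih =>
          rw [pow_succ']
          exact hstep _ _ _ ih (hu _ ((E.rot_fst _).trans ih.1))
      obtain ⟨n, hn⟩ := E.rot_vertex d d' (hd.1.trans hd'.1.symm)
      have := hall n
      rw [hn] at this
      obtain ⟨_, h1, h2⟩ := this
      obtain ⟨_, h3, h4⟩ := hd'
      exact h2.symm.trans h4
    let m : (Σ i, {v // v ∈ W i}) → {v // U v} ⊕ D1 := fun x =>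
      if h : U x.2.1 then Sum.inl ⟨x.2.1, h⟩
      else Sum.inr ⟨kd x, (hkd x h).1.2.1, by rw [← hf]; exact (hkd x h).2⟩
    refine Fintype.card_le_of_injective m ?_
    intro x y hxy
    by_cases hx : U x.2.1 <;> by_cases hy : U y.2.1
    · simp only [m, hx, hy, dif_pos, Sum.inl.injEq, Subtype.mk.injEq] at hxy
      obtain ⟨i, v, hv⟩ := x
      obtain ⟨j, w, hw⟩ := y
      simp only at hxy hx hy
      subst hxy
      obtain rfl := uniq v hx i j hv hw
      rfl
    · simp [m, hx, hy] at hxy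
    · simp [m, hx, hy] at hxy
    · simp only [m, hx, hy, dif_neg, not_false_eq_true, Sum.inr.injEq] at hxy
      replace hxy : kd x = kd y := congrArg Subtype.val hxy
      have a := (hkd x hx).1
      have b := (hkd y hy).1
      rw [← hxy] at b
      obtain ⟨i, v, hv⟩ := x
      obtain ⟨j, w, hw⟩ := y
      obtain ⟨a1, a2, a3⟩ := a
      obtain ⟨b1, b2, b3⟩ := b
      simp only at a1 a3 b1 b3
      obtain rfl := a1.symm.trans b1
      obtain rfl := a3.symm.trans b3
      rfl
  have E4 : Fintype.card V + Fintype.card E.Face = Fintype.card G.edgeSet + 2 := by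
    have := E.euler
    simp only [Nat.card_eq_fintype_card] at this
    convert this
  have E5 : Fintype.card E.Face = Fintype.card {F // P F} + Fintype.card {F // ¬ P F} :=
    (Fintype.card_subtype_compl P ▸ by have := Fintype.card_subtype_le P; omega)
  have E6 : Fintype.card V = Fintype.card {v // U v} +
      Fintype.card {v : V // ∃ d : G.Dart, d.fst = v ∧ P (f d)} := by
    have h1 : Fintype.card {v : V // ∃ d : G.Dart, d.fst = v ∧ P (f d)} = Fintype.card {v // ¬ U v} := by
      refine Fintype.card_congr (Equiv.subtypeEquivRight fun v => ?_)
      simp [U]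
    rw [h1, Fintype.card_subtype_compl U]
    have := Fintype.card_subtype_le U
    omega
  have E7 : Fintype.card {d : G.Dart // P (f d)} = 2 * Fintype.card κ2 + Fintype.card D1 := by
    simp only [κ2, D1, Fintype.card_subtype, Finset.card_filter]
    rw [dart_sum dt hdt, dart_sum dt hdt, Finset.mul_sum, ← Finset.sum_add_distrib]
    refine Finset.sum_congr rfl fun e _ => ?_
    rw [SimpleGraph.Dart.symm_symm]
    by_cases h1 : P (f (dt e)) <;> by_cases h2 : P (f (dt e).symm) <;> simp [h1, h2]
  have E8 : Fintype.card G.edgeSet = Fintype.card κ0 + Fintype.card κ2 + Fintype.card D1 := by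
    rw [← Finset.card_univ (α := G.edgeSet)]
    simp only [κ2, κ0, D1, Fintype.card_subtype, Finset.card_filter]
    rw [dart_sum dt hdt, ← Finset.sum_add_distrib, ← Finset.sum_add_distrib, Finset.card_eq_sum_ones]
    refine Finset.sum_congr rfl fun e _ => ?_
    rw [SimpleGraph.Dart.symm_symm]
    by_cases h1 : P (f (dt e)) <;> by_cases h2 : P (f (dt e).symm) <;> simp [h1, h2]
  simp only [Nat.card_eq_fintype_card]
  omega

theorem face_deg {V : Type} [Fintype V] (G : SimpleGraph V) (E : PlaneEmb G)
    (F : E.Face) (hF : F ≠ E.outer) : 3 ≤ Nat.card {d : G.Dart // E.dartFace d = F} := by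
  classical
  set φ := E.rot * dartSymmPerm G with hφ
  have hφd : ∀ d, φ d = E.rot d.symm := fun d => rfl
  obtain ⟨d, rfl⟩ := Quotient.mk_surjective F
  have hface : ∀ d, E.dartFace (φ d) = E.dartFace d := fun d =>
    Quotient.sound (Equiv.Perm.SameCycle.symm ⟨1, by simp [hφ]⟩)
  have hfst : ∀ d, (φ d).fst = d.snd := fun d => E.rot_fst _
  have n1 : ∀ d, φ d ≠ d := by
    intro d h
    have := hfst d
    rw [h] at this
    exact d.fst_ne_snd this
  have n2 : φ (φ d) ≠ d := by
    intro h
    have e1 : φ d = d.symm := by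
      have h1 := hfst (φ d)
      rw [h] at h1
      exact SimpleGraph.Dart.ext _ _ (Prod.ext (hfst d) h1.symm)
    have r1 : E.rot d.symm = d.symm := e1
    have r2 : E.rot d = d := by
      rw [e1, hφd, SimpleGraph.Dart.symm_symm] at h; exact h
    have p1 : ∀ n : ℕ, (E.rot ^ n) d = d := fun n => by
      induction n with
      | zero => rfl
      | succ n ih => rw [pow_succ, Equiv.Perm.mul_apply, r2, ih]
    have p2 : ∀ n : ℕ, (E.rot ^ n) d.symm = d.symm := fun n => by
      induction n with
      | zero => rfl
      | succ n ih => rw [pow_succ, Equiv.Perm.mul_apply, r1, ih]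
    have a1 : ∀ d' : G.Dart, d'.fst = d.fst → d' = d := by
      intro d' h'
      obtain ⟨n, hn⟩ := E.rot_vertex d d' h'.symm
      rw [← hn, p1]
    have a2 : ∀ d' : G.Dart, d'.fst = d.snd → d' = d.symm := by
      intro d' h'
      obtain ⟨n, hn⟩ := E.rot_vertex d.symm d' h'.symm
      rw [← hn, p2]
    have hv : ∀ v, v = d.fst ∨ v = d.snd := by
      intro v
      have hx : d.fst = d.fst ∨ d.fst = d.snd := Or.inl rfl
      generalize hxx : d.fst = x at hx
      rw [← hxx]
      have hx' : x = d.fst ∨ x = d.snd := Or.inl hxx.symm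
      clear hx hxx
      obtain ⟨w⟩ := E.connected.preconnected x v
      induction w with
      | nil => exact hx'
      | cons hadj w ih =>
        apply ih
        rcases hx' with h | h
        · have := a1 ⟨(_, _), hadj⟩ h
          right; rw [← this]
        · have := a2 ⟨(_, _), hadj⟩ h
          left
          have h3 := congrArg (fun d : G.Dart => d.snd) this
          exact h3
    have hall : ∀ d', E.dartFace d' = E.dartFace d := by
      intro d'
      rcases hv d'.fst with h | h
      · rw [a1 d' h]
      · rw [a2 d' h, ← e1, hface]
    apply hF
    obtain ⟨d', hd'⟩ := Quotient.mk_surjective E.outer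
    rw [← hd']
    exact (hall d').symm
  have : ({d, φ d, φ (φ d)} : Finset G.Dart) ⊆ Finset.univ.filter (fun d' => E.dartFace d' = E.dartFace d) := by
    intro x hx
    simp only [Finset.mem_insert, Finset.mem_singleton] at hx
    simp only [Finset.mem_filter, Finset.mem_univ, true_and]
    rcases hx with rfl | rfl | rfl
    · rfl
    · exact hface _
    · rw [hface, hface]
  have hc := Finset.card_le_card this
  rw [Finset.card_eq_three.2 ⟨d, φ d, φ (φ d), (n1 d).symm, n2.symm, (n1 _).symm, rfl⟩] at hc
  rw [Nat.card_eq_fintype_card, Fintype.card_subtype]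
  exact hc

/-- If we do not require the generalized Laman property, every generically rigid plane graph
possesses a CPT-labelling (obtained by labelling a minimally rigid spanning subgraph as a
pointed CPT and inserting the remaining edges one at a time, relabelling only angles of the
subdivided face and sacrificing at most one pointed vertex per inserted edge). -/
theorem genRigid_plane_graph_has_cpt_labelling
    {V : Type} [Fintype V] [DecidableEq V] (G : SimpleGraph V)
    (E : PlaneEmb G) (hrig : GenRigid G) :
    ∃ big : G.Dart → Prop, IsCPTLabelling E big := by
  classical
  have : Fintype E.Face := Fintype.ofFinite _
  have hang : ∀ d, E.angleFace d = E.dartFace (E.rot d) := fun d =>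
    Quotient.sound ⟨1, by simp [dartSymmPerm]⟩
  let deg : E.Face → ℕ := fun F => Nat.card {d : G.Dart // E.dartFace d = F}
  have hdeg : ∀ F, (Finset.univ.filter fun d : G.Dart => E.angleFace d = F).card = deg F := by
    intro F
    simp only [deg]
    rw [Nat.card_eq_fintype_card, ← Fintype.card_subtype]
    refine Fintype.card_congr (E.rot.subtypeEquiv fun d => ?_)
    rw [hang]
  let dem : E.Face → ℕ := fun F => if F = E.outer then deg F else deg F - 3
  have hdem : ∀ F, dem F + 3 = deg F + if F = E.outer then 3 else 0 := by
    intro F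
    by_cases h : F = E.outer
    · simp [dem, h]
    · have : 3 ≤ deg F := face_deg G E F h
      simp only [dem, h, if_false]
      omega
  let t : (Σ F, Fin (dem F)) → Finset V := fun s =>
    Finset.univ.filter fun v => ∃ d : G.Dart, d.fst = v ∧ E.dartFace d = s.1
  have hall : ∀ s : Finset (Σ F, Fin (dem F)), s.card ≤ (s.biUnion t).card := by
    intro s
    rcases s.eq_empty_or_nonempty with rfl | hne
    · simp
    set Q : Finset E.Face := s.image Sigma.fst with hQ
    have h1 : s.card ≤ ∑ F ∈ Q, dem F := by
      have : s ⊆ Q.sigma (fun F => (Finset.univ : Finset (Fin (dem F)))) := by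
        intro x hx
        simp only [Finset.mem_sigma, Finset.mem_univ, and_true]
        exact Finset.mem_image_of_mem _ hx
      refine (Finset.card_le_card this).trans ?_
      simp [Finset.card_sigma]
    have h2 : ∑ F ∈ Q, dem F + 3 * Q.card ≤ ∑ F ∈ Q, deg F + 3 := by
      have : ∑ F ∈ Q, (dem F + 3) = ∑ F ∈ Q, (deg F + if F = E.outer then 3 else 0) :=
        Finset.sum_congr rfl fun F _ => hdem F
      rw [Finset.sum_add_distrib, Finset.sum_add_distrib, Finset.sum_const, Finset.sum_ite_eq'] at this
      simp only [smul_eq_mul] at this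
      split_ifs at this <;> omega
    have h3 := hall_count G E hrig (fun F => F ∈ Q) (by
      obtain ⟨x, hx⟩ := hne
      exact ⟨x.1, Finset.mem_image_of_mem _ hx⟩)
    have h4 : Nat.card {d : G.Dart // E.dartFace d ∈ Q} = ∑ F ∈ Q, deg F := by
      rw [Nat.card_eq_fintype_card, Fintype.card_subtype]
      rw [Finset.card_eq_sum_card_fiberwise (f := E.dartFace) (t := Q) (by intro x hx; simpa using hx)]
      refine Finset.sum_congr rfl fun F hF => ?_
      simp only [deg]
      rw [Nat.card_eq_fintype_card, Fintype.card_subtype]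
      congr 1
      ext d
      simp only [Finset.mem_filter, Finset.mem_univ, true_and]
      constructor
      · exact fun h => h.2
      · exact fun h => ⟨h ▸ hF, h⟩
    have h5 : Nat.card {F // F ∈ Q} = Q.card := by simp
    have h6 : Nat.card {v : V // ∃ d : G.Dart, d.fst = v ∧ E.dartFace d ∈ Q} = (s.biUnion t).card := by
      rw [Nat.card_eq_fintype_card, Fintype.card_subtype]
      congr 1
      ext v
      simp only [Finset.mem_filter, Finset.mem_univ, true_and, Finset.mem_biUnion, t]
      constructor
      · rintro ⟨d, hd, hdQ⟩
        obtain ⟨x, hx, hxd⟩ := Finset.mem_image.1 hdQ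
        exact ⟨x, hx, d, hd, hxd.symm⟩
      · rintro ⟨x, hx, d, hd, hxd⟩
        exact ⟨d, hd, hxd ▸ Finset.mem_image_of_mem _ hx⟩
    rw [h4, h5, h6] at h3
    omega
  obtain ⟨m, hm, hmt⟩ := (Finset.all_card_le_biUnion_card_iff_exists_injective t).1 hall
  have hb : ∀ s, ∃ d : G.Dart, d.fst = m s ∧ E.angleFace d = s.1 := by
    intro s
    have := hmt s
    simp only [t, Finset.mem_filter, Finset.mem_univ, true_and] at this
    obtain ⟨d, h1, h2⟩ := this
    refine ⟨E.rot.symm d, ?_, ?_⟩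
    · rw [← E.rot_fst, Equiv.apply_symm_apply, h1]
    · rw [hang, Equiv.apply_symm_apply, h2]
  choose b hb1 hb2 using hb
  have hbinj : Function.Injective b := fun s s' h => hm (by rw [← hb1, ← hb1, h])
  have hbig : ∀ F, (Finset.univ.filter fun d : G.Dart => E.angleFace d = F ∧ ∃ s, b s = d).card = dem F := by
    intro F
    have : (Finset.univ.filter fun d : G.Dart => E.angleFace d = F ∧ ∃ s, b s = d)
        = (Finset.univ : Finset (Fin (dem F))).image (fun i => b ⟨F, i⟩) := by
      ext d
      simp only [Finset.mem_filter, Finset.mem_univ, true_and, Finset.mem_image]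
      constructor
      · rintro ⟨h1, ⟨F', i⟩, rfl⟩
        rw [hb2] at h1
        simp only at h1
        subst h1
        exact ⟨i, rfl⟩
      · rintro ⟨i, rfl⟩
        exact ⟨hb2 _, _, rfl⟩
    rw [this, Finset.card_image_of_injective _ (fun i j h => by simpa using hbinj h)]
    simp
  have hsplit : ∀ F, (Finset.univ.filter fun d : G.Dart => E.angleFace d = F ∧ ∃ s, b s = d).card +
      (Finset.univ.filter fun d : G.Dart => E.angleFace d = F ∧ ¬ ∃ s, b s = d).card = deg F := by
    intro F
    rw [← hdeg, ← Finset.card_filter_add_card_filter_not (s := Finset.univ.filter fun d : G.Dart => E.angleFace d = F)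
      (fun d => ∃ s, b s = d), Finset.filter_filter, Finset.filter_filter]
  refine ⟨fun d => ∃ s, b s = d, ?_, ?_, ?_⟩
  · intro F hF
    have h1 := hsplit F
    have h2 := hdem F
    rw [hbig] at h1
    simp only [hF, if_false] at h2
    have h3 : (Finset.univ.filter fun d : G.Dart => E.angleFace d = F ∧ ¬ ∃ s, b s = d).card = 3 := by omega
    rw [← h3, ← Fintype.card_subtype, ← Nat.card_eq_fintype_card]
    rfl
  · intro d hd
    have h1 := hsplit E.outer
    rw [hbig] at h1
    have h2 : dem E.outer = deg E.outer := by simp [dem]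
    have h3 : (Finset.univ.filter fun d : G.Dart => E.angleFace d = E.outer ∧ ¬ ∃ s, b s = d).card = 0 := by omega
    rw [Finset.card_eq_zero] at h3
    by_contra hcon
    have : d ∈ (Finset.univ.filter fun d : G.Dart => E.angleFace d = E.outer ∧ ¬ ∃ s, b s = d) := by
      simp only [Finset.mem_filter, Finset.mem_univ, true_and]
      exact ⟨hd, hcon⟩
    rw [h3] at this
    simp at this
  · rintro d d' ⟨s, rfl⟩ ⟨s', rfl⟩ h
    rw [hb1, hb1] at h
    rw [hm h]
end
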